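/- arXiv:1609.08077 — 2 statements merged into one kernel-verified Lean document; each statement's English description precedes it below -/
import Mathlib

section
/- Let A, B be twisted complexes over R. Extend totalization to morphisms of arbitrary bidegree: for f ∈ wbimod(A,B)_u^v and a ∈ Tot(A)^n, set (Tot(f)(a))_{j+u} := Σ_{m≥0} (−1)^{(m+u)n} f_m(a_{j+m}). Then: (i) Tot(f) maps F_q Tot(A)^n into F_{q+u} Tot(B)^{n+v−u} for all q, n; (ii) the map f ↦ Tot(f) is a bijection from wbimod(A,B)_u^v onto the set of graded maps g : Tot(A)^* → Tot(B)^{*+v−u} with g(F_q Tot(A)^n) ⊆ F_{q+u} Tot(B)^{n+v−u} for all q, n; (iii) Tot respects composition: Tot(c(f,g)) = (−1)^{u_f |g|} Tot(f)∘Tot(g) for f of bidegree (u_f, v_f), and Tot(1) = 1; (iv) Tot commutes with the differentials: Tot(δ(f)) = d^{Tot(B)}∘Tot(f) − (−1)^{|f|} Tot(f)∘d^{Tot(A)}. Consequently totalization is an isomorphism of vertical-bicomplex-enriched categories from twisted complexes onto split filtered complexes. -/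
open Finset

noncomputable section

/-- A `(ℤ,ℤ)`-bigraded `R`-module. -/
structure Bigraded (R : Type) [CommRing R] where
  M : ℤ → ℤ → Type
  [acg : ∀ i j, AddCommGroup (M i j)]
  [mod : ∀ i j, Module R (M i j)]

attribute [instance] Bigraded.acg Bigraded.mod

variable {R : Type} [CommRing R]

/-- Transport along equalities of bidegrees. -/
def Bigraded.cast (A : Bigraded R) {i i' j j' : ℤ} (hi : i = i') (hj : j = j') :
    A.M i j →ₗ[R] A.M i' j' := by subst hi; subst hj; exact LinearMap.id

/-- Maps of bigraded modules of bidegree `(p,q)`. -/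
abbrev GMap (A B : Bigraded R) (p q : ℤ) : Type :=
  ∀ i j : ℤ, A.M i j →ₗ[R] B.M (i + p) (j + q)

/-- Change the recorded bidegree of a graded map along equalities of bidegrees. -/
def grecast {A B : Bigraded R} {p q : ℤ} (p' q' : ℤ) (hp : p = p') (hq : q = q')
    (f : GMap A B p q) : GMap A B p' q' :=
  fun i j => (B.cast (by rw [hp]) (by rw [hq])).comp (f i j)

/-- Composition of graded maps: apply `f` first, then `g`. -/
def gcomp {A B C : Bigraded R} {p q p' q' : ℤ} (g : GMap B C p' q') (f : GMap A B p q) :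
    GMap A C (p + p') (q + q') :=
  fun i j => (C.cast (by ring) (by ring)).comp ((g (i + p) (j + q)).comp (f i j))

/-- The identity as a graded map of bidegree `(0,0)`. -/
def idG (A : Bigraded R) : GMap A A 0 0 := fun i j => A.cast (by ring) (by ring)

/-- An element of `wbimod(A,B)_u^v`, i.e. a family of bigraded maps `f_m : A → B` of
bidegree `(u-m, v-m)` for `m ≥ 0`. -/
abbrev WMap (A B : Bigraded R) (u v : ℤ) : Type :=
  ∀ m : ℕ, GMap A B (u - (m : ℤ)) (v - (m : ℤ))

/-- The family of maps `(d_m)` makes `A` into a twisted complex: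
`∑_{i+j=m} (-1)^i d_i d_j = 0` for all `m ≥ 0`. -/
def IsTwDiff (A : Bigraded R) (d : WMap A A 0 1) : Prop :=
  ∀ m : ℕ, ∑ ij ∈ (antidiagonal m).attach,
      ((-1 : ℤ) ^ ij.1.1) •
        grecast (0 - (m : ℤ)) (2 - (m : ℤ))
          (by have := mem_antidiagonal.mp ij.2; omega)
          (by have := mem_antidiagonal.mp ij.2; omega)
          (gcomp (d ij.1.1) (d ij.1.2)) = 0

/-- The family `(f_m)` is a morphism of twisted complexes from `(A, dA)` to `(B, dB)`:
`∑_{i+j=m} d_i^B f_j = ∑_{i+j=m} (-1)^i f_i d_j^A` for all `m ≥ 0`. -/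
def IsTwMor {A B : Bigraded R} (dA : WMap A A 0 1) (dB : WMap B B 0 1)
    (f : WMap A B 0 0) : Prop :=
  ∀ m : ℕ,
    (∑ ij ∈ (antidiagonal m).attach,
      grecast (0 - (m : ℤ)) (1 - (m : ℤ))
        (by have := mem_antidiagonal.mp ij.2; omega)
        (by have := mem_antidiagonal.mp ij.2; omega)
        (gcomp (dB ij.1.1) (f ij.1.2)))
    = ∑ ij ∈ (antidiagonal m).attach,
      ((-1 : ℤ) ^ ij.1.1) •
        grecast (0 - (m : ℤ)) (1 - (m : ℤ))
          (by have := mem_antidiagonal.mp ij.2; omega)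
          (by have := mem_antidiagonal.mp ij.2; omega)
          (gcomp (f ij.1.1) (dA ij.1.2))

/-- A twisted complex (multicomplex) over `R`. -/
structure TwComplex (R : Type) [CommRing R] extends Bigraded R where
  d : WMap toBigraded toBigraded 0 1
  isTw : IsTwDiff toBigraded d

/-- A morphism of twisted complexes. -/
structure TwMorphism (A B : TwComplex R) where
  f : WMap A.toBigraded B.toBigraded 0 0
  isMor : IsTwMor A.d B.d f

/-- Composition of families: `(g ∘ f)_m = ∑_{i+j=m} g_i f_j`. -/
def compFam {A B C : Bigraded R} (g : WMap B C 0 0) (f : WMap A B 0 0) : WMap A C 0 0 :=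
  fun m => ∑ ij ∈ (antidiagonal m).attach,
    grecast (0 - (m : ℤ)) (0 - (m : ℤ))
      (by have := mem_antidiagonal.mp ij.2; omega)
      (by have := mem_antidiagonal.mp ij.2; omega)
      (gcomp (g ij.1.1) (f ij.1.2))

/-- A strict family: concentrated in stage `0`. -/
def strictW {A B : Bigraded R} (g : GMap A B 0 0) : WMap A B 0 0 :=
  fun m => if h : m = 0 then grecast (0 - (m : ℤ)) (0 - (m : ℤ)) (by omega) (by omega) g else 0

/-- The identity family of maps. -/
def idW (A : Bigraded R) : WMap A A 0 0 := strictW (idG A)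

/-! ## The enriched hom `wbimod` : composition and differential -/

/-- Composition in `wbimod` : `c(f,g)_m := ∑_{i+j=m} (-1)^{i|g|} f_i g_j`, where `|g| = v' - u'`
is the total degree of `g`. -/
def wcomp {A B C : Bigraded R} {u v u' v' : ℤ} (f : WMap B C u v) (g : WMap A B u' v') :
    WMap A C (u + u') (v + v') :=
  fun m => ∑ ij ∈ (antidiagonal m).attach,
    (Int.negOnePow ((ij.1.1 : ℤ) * (v' - u')) : ℤ) •
      grecast ((u + u') - (m : ℤ)) ((v + v') - (m : ℤ))
        (by have := mem_antidiagonal.mp ij.2; omega)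
        (by have := mem_antidiagonal.mp ij.2; omega)
        (gcomp (f ij.1.1) (g ij.1.2))

/-- Change the recorded bidegree of a `wbimod` element. -/
def wrecast {A B : Bigraded R} {u v : ℤ} (u' v' : ℤ) (hu : u = u') (hv : v = v')
    (f : WMap A B u v) : WMap A B u' v' :=
  fun m => grecast (u' - (m : ℤ)) (v' - (m : ℤ)) (by rw [hu]) (by rw [hv]) (f m)

/-- The vertical differential on `wbimod(A,B)` induced by twisted-complex structures:
`δ(f) := c(d^B, f) - (-1)^{⟨f, d^A⟩} c(f, d^A)`. -/
def wdelta {A B : Bigraded R} (dA : WMap A A 0 1) (dB : WMap B B 0 1) {u v : ℤ}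
    (f : WMap A B u v) : WMap A B u (v + 1) :=
  wrecast u (v + 1) (by ring) (by ring) (wcomp dB f)
  - (Int.negOnePow (u * 0 + v * 1) : ℤ) • wrecast u (v + 1) (by ring) (by ring) (wcomp f dA)

/-! ## Totalization -/

/-- The underlying graded module of the totalization:
`Tot(A)^n = Π_{i≤0} A_i^{n+i} ⊕ ⊕_{i>0} A_i^{n+i}`, realized as the submodule of
`Π_i A_i^{n+i}` of elements whose components vanish for `i` large. -/
def totCarrier (A : Bigraded R) (n : ℤ) : Submodule R (∀ i : ℤ, A.M i (n + i)) where
  carrier := {a | ∃ N : ℤ, ∀ i : ℤ, N ≤ i → a i = 0}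
  add_mem' := by
    rintro a b ⟨N, hN⟩ ⟨N', hN'⟩
    exact ⟨max N N', fun i hi => by
      have h1 := hN i (le_trans (le_max_left _ _) hi)
      have h2 := hN' i (le_trans (le_max_right _ _) hi)
      simp [h1, h2]⟩
  zero_mem' := ⟨0, fun i _ => rfl⟩
  smul_mem' := by
    rintro c a ⟨N, hN⟩
    exact ⟨N, fun i hi => by simp [hN i hi]⟩

/-- `Tot(A)^n`. -/
abbrev TotM (A : Bigraded R) (n : ℤ) : Type := ↥(totCarrier A n)

/-- The column filtration: `F_p Tot(A)^n = Π_{i ≤ p} A_i^{n+i}`. -/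
def totFilt (A : Bigraded R) (p n : ℤ) : Submodule R (TotM A n) where
  carrier := {a | ∀ i : ℤ, p < i → (a : ∀ i : ℤ, A.M i (n + i)) i = 0}
  add_mem' := by
    intro a b ha hb i hi
    simp [ha i hi, hb i hi]
  zero_mem' := fun i _ => rfl
  smul_mem' := by
    intro c a ha i hi
    simp [ha i hi]

/-- Transport of totalizations along an equality of degrees. -/
def totCastL (A : Bigraded R) {n n' : ℤ} (h : n = n') : TotM A n →ₗ[R] TotM A n' := by
  subst h; exact LinearMap.id

/-- The `m`-th term of the totalization of a `wbimod`-element `F` of bidegree `(u,v)`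
applied to `a`, in column `k`: `(-1)^{(m+u)n} F_m(a_{k-u+m})`. -/
def totTerm {A B : Bigraded R} {u v : ℤ} (F : WMap A B u v) (n : ℤ)
    (a : ∀ i : ℤ, A.M i (n + i)) (k : ℤ) (m : ℕ) : B.M k ((n + v - u) + k) :=
  (Int.negOnePow (((m : ℤ) + u) * n) : ℤ) •
    B.cast (by ring) (by ring) (F m (k - u + m) (n + (k - u + m)) (a (k - u + m)))

theorem totTerm_eq_zero {A B : Bigraded R} {u v : ℤ} (F : WMap A B u v) (n : ℤ)
    (a : ∀ i : ℤ, A.M i (n + i)) (k : ℤ) (m : ℕ) (h : a (k - u + m) = 0) :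
    totTerm F n a k m = 0 := by
  simp [totTerm, h]

theorem totTerm_support_finite {A B : Bigraded R} {u v : ℤ} (F : WMap A B u v) (n : ℤ)
    (a : ∀ i : ℤ, A.M i (n + i)) (ha : a ∈ totCarrier A n) (k : ℤ) :
    (Function.support (totTerm F n a k)).Finite := by
  obtain ⟨N, hN⟩ := ha
  apply Set.Finite.subset (Set.finite_Iio (N - k + u).toNat)
  intro m hm
  rw [Function.mem_support] at hm
  rw [Set.mem_Iio]
  by_contra hc
  push_neg at hc
  exact hm (totTerm_eq_zero _ _ _ _ _ (hN _ (by omega)))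

/-- The underlying function of the totalization of `F` applied to `a`. -/
def totFun {A B : Bigraded R} {u v : ℤ} (F : WMap A B u v) (n : ℤ) (a : TotM A n)
    (k : ℤ) : B.M k ((n + v - u) + k) :=
  ∑ᶠ m : ℕ, totTerm F n a.1 k m

theorem totFun_mem {A B : Bigraded R} {u v : ℤ} (F : WMap A B u v) (n : ℤ) (a : TotM A n) :
    totFun F n a ∈ totCarrier B (n + v - u) := by
  obtain ⟨N, hN⟩ := a.2
  exact ⟨N + u, fun k hk => finsum_eq_zero_of_forall_eq_zero
    fun m => totTerm_eq_zero _ _ _ _ _ (hN _ (by omega))⟩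

/-- The totalization of a `wbimod`-element `F` of bidegree `(u,v)`:
`(Tot(F)(a))_{j+u} = ∑_{m≥0} (-1)^{(m+u)n} F_m(a_{j+m})`. -/
def totGen {A B : Bigraded R} {u v : ℤ} (F : WMap A B u v) (n : ℤ) :
    TotM A n →ₗ[R] TotM B (n + v - u) where
  toFun a := ⟨totFun F n a, totFun_mem F n a⟩
  map_add' a b := by
    apply Subtype.ext
    funext k
    have h1 := totTerm_support_finite F n a.1 a.2 k
    have h2 := totTerm_support_finite F n b.1 b.2 k
    have key : (fun m => totTerm F n (↑(a + b)) k m)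
        = fun m => totTerm F n a.1 k m + totTerm F n b.1 k m := by
      funext m
      simp [totTerm, smul_add]
    show (∑ᶠ m, totTerm F n (↑(a + b)) k m) = _
    rw [key, finsum_add_distrib h1 h2]
    rfl
  map_smul' c a := by
    apply Subtype.ext
    funext k
    have h1 := totTerm_support_finite F n a.1 a.2 k
    have key : (fun m => totTerm F n (↑(c • a)) k m)
        = fun m => c • totTerm F n a.1 k m := by
      funext m
      show totTerm F n (c • a.1) k m = _
      simp only [totTerm, Pi.smul_apply, map_smul]
      rw [smul_comm]
    show (∑ᶠ m, totTerm F n (↑(c • a)) k m) = _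
    rw [key]
    rw [finsum_eq_finset_sum_of_support_subset _
      (s := h1.toFinset) (by
        intro m hm
        rw [Function.mem_support] at hm
        simp only [Finset.mem_coe, Set.Finite.mem_toFinset, Function.mem_support]
        intro h0
        exact hm (by rw [h0, smul_zero])),
      ← Finset.smul_sum, ← finsum_eq_sum _ h1]
    rfl

/-- The totalization of a twisted-complex structure, as the differential on `Tot(A)`. -/
def totDW {A : Bigraded R} (d : WMap A A 0 1) (n : ℤ) : TotM A n →ₗ[R] TotM A (n + 1) :=
  (totCastL A (by ring)).comp (totGen d n)

/-- The totalization of a morphism family `f` of bidegree `(0,0)`. -/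
def totMorW {A B : Bigraded R} (f : WMap A B 0 0) (n : ℤ) : TotM A n →ₗ[R] TotM B n :=
  (totCastL B (by ring)).comp (totGen f n)

theorem Bigraded.cast_cast (A : Bigraded R) {i i' i'' j j' j'' : ℤ} (hi : i = i') (hj : j = j')
    (hi' : i' = i'') (hj' : j' = j'') (x : A.M i j) :
    A.cast hi' hj' (A.cast hi hj x) = A.cast (hi.trans hi') (hj.trans hj') x := by
  subst hi hj hi' hj'; rfl

theorem Bigraded.cast_self (A : Bigraded R) {i j : ℤ} (hi : i = i) (hj : j = j) (x : A.M i j) :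
    A.cast hi hj x = x :=
  rfl

theorem GMap.apply_cast {A B : Bigraded R} {p q : ℤ} (f : GMap A B p q) {i i' j j' : ℤ}
    (hi : i = i') (hj : j = j') (x : A.M i j) :
    f i' j' (A.cast hi hj x) = B.cast (by rw [hi]) (by rw [hj]) (f i j x) := by
  subst hi hj; rfl

theorem totCastL_apply (A : Bigraded R) {n n' : ℤ} (h : n = n') (a : TotM A n) (k : ℤ) :
    (totCastL A h a).1 k = A.cast rfl (by rw [h]) (a.1 k) := by
  subst h; rfl

theorem totCastL_totCastL (A : Bigraded R) {n n' n'' : ℤ} (h : n = n') (h' : n' = n'')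
    (a : TotM A n) : totCastL A h' (totCastL A h a) = totCastL A (h.trans h') a := by
  subst h h'; rfl

theorem totGen_totCastL {A B : Bigraded R} {u v : ℤ} (F : WMap A B u v) {n n' : ℤ} (h : n = n')
    (a : TotM A n) :
    totGen F n' (totCastL A h a) = totCastL B (by rw [h]) (totGen F n a) := by
  subst h; rfl

theorem totGen_wrecast {A B : Bigraded R} {u v u' v' : ℤ} (hu : u = u') (hv : v = v')
    (F : WMap A B u v) (n : ℤ) (a : TotM A n) :
    totGen (wrecast u' v' hu hv F) n a = totCastL B (by rw [hu, hv]) (totGen F n a) := by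
  subst hu hv; rfl

theorem TotM.exists_bound {A : Bigraded R} {n : ℤ} (a : TotM A n) (k : ℤ) :
    ∃ M : ℕ, ∀ i : ℤ, k + M ≤ i → a.1 i = 0 := by
  obtain ⟨N, hN⟩ := a.2
  exact ⟨(N - k).toNat, fun i hi => hN _ (by omega)⟩

theorem totGen_apply_eq_sum {A B : Bigraded R} {u v : ℤ} (F : WMap A B u v) (n : ℤ)
    (a : TotM A n) (k : ℤ) (M : ℕ) (hM : ∀ i : ℤ, k - u + M ≤ i → a.1 i = 0) :
    (totGen F n a).1 k = ∑ m ∈ range M, totTerm F n a.1 k m := by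
  refine finsum_eq_finsetSum_of_support_subset _ fun m hm => ?_
  rw [Finset.coe_range, Set.mem_Iio]
  by_contra h
  exact hm (totTerm_eq_zero _ _ _ _ _ (hM _ (by omega)))

theorem totGen_mem_totFilt {A B : Bigraded R} {u v : ℤ} (F : WMap A B u v) {q n : ℤ}
    {a : TotM A n} (ha : a ∈ totFilt A q n) :
    totGen F n a ∈ totFilt B (q + u) (n + v - u) := fun _ hk =>
  finsum_eq_zero_of_forall_eq_zero fun _ => totTerm_eq_zero _ _ _ _ _ (ha _ (by omega))

theorem totGen_sub {A B : Bigraded R} {u v : ℤ} (F G : WMap A B u v) (n : ℤ) :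
    totGen (F - G) n = totGen F n - totGen G n := by
  refine LinearMap.ext fun a => Subtype.ext (funext fun k => ?_)
  obtain ⟨M, hM⟩ := a.exists_bound (k - u)
  change _ = (totGen F n a).1 k - (totGen G n a).1 k
  simp only [totGen_apply_eq_sum _ _ _ _ M hM, ← Finset.sum_sub_distrib]
  refine Finset.sum_congr rfl fun m _ => ?_
  simp only [totTerm, Pi.sub_apply, LinearMap.sub_apply, map_sub, smul_sub]

theorem totGen_zsmul {A B : Bigraded R} {u v : ℤ} (c : ℤ) (F : WMap A B u v) (n : ℤ) :
    totGen (c • F) n = c • totGen F n := by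
  refine LinearMap.ext fun a => Subtype.ext (funext fun k => ?_)
  obtain ⟨M, hM⟩ := a.exists_bound (k - u)
  change _ = c • (totGen F n a).1 k
  simp only [totGen_apply_eq_sum _ _ _ _ M hM, Finset.smul_sum]
  refine Finset.sum_congr rfl fun m _ => ?_
  simp only [totTerm, Pi.smul_apply, LinearMap.smul_apply, map_zsmul]
  rw [smul_comm]

/-- The inclusion of the `i`-th column into `Tot(A)^n`. -/
def totSingle (A : Bigraded R) (n i : ℤ) : A.M i (n + i) →ₗ[R] TotM A n :=
  (LinearMap.single R (fun i => A.M i (n + i)) i).codRestrict (totCarrier A n) fun x =>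
    ⟨i + 1, fun j hj => Pi.single_eq_of_ne (M := fun i => A.M i (n + i)) (show j ≠ i by omega) x⟩

theorem totSingle_same (A : Bigraded R) (n i : ℤ) (x : A.M i (n + i)) :
    (totSingle A n i x).1 i = x :=
  Pi.single_eq_same (M := fun i => A.M i (n + i)) i x

theorem totSingle_of_ne (A : Bigraded R) (n : ℤ) {i j : ℤ} (h : j ≠ i) (x : A.M i (n + i)) :
    (totSingle A n i x).1 j = 0 :=
  Pi.single_eq_of_ne (M := fun i => A.M i (n + i)) h x

theorem negOnePow_smul_negOnePow_smul {M : Type*} [AddCommGroup M] (n : ℤ) (x : M) :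
    (Int.negOnePow n : ℤ) • (Int.negOnePow n : ℤ) • x = x := by
  rw [smul_smul, ← Units.val_mul, Int.units_mul_self, Units.val_one, one_smul]

theorem totTerm_totSingle {A B : Bigraded R} {u v : ℤ} (F : WMap A B u v) (n i k : ℤ) (m : ℕ)
    (h : i = k - u + m) (x : A.M i (n + i)) :
    totTerm F n (totSingle A n i x).1 k m =
      (Int.negOnePow (((m : ℤ) + u) * n) : ℤ) •
        B.cast (by omega) (by omega) (F m i (n + i) x) := by
  subst h
  rw [totTerm, totSingle_same]

theorem totGen_totSingle {A B : Bigraded R} {u v : ℤ} (F : WMap A B u v) (n i k : ℤ) (m : ℕ)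
    (h : i = k - u + m) (x : A.M i (n + i)) :
    (totGen F n (totSingle A n i x)).1 k =
      (Int.negOnePow (((m : ℤ) + u) * n) : ℤ) •
        B.cast (by omega) (by omega) (F m i (n + i) x) := by
  rw [← totTerm_totSingle F n i k m h x]
  exact finsum_eq_single _ _ fun m' hm' =>
    totTerm_eq_zero _ _ _ _ _ (totSingle_of_ne A n (by omega) x)

theorem totGen_injective {A B : Bigraded R} {u v : ℤ} :
    Function.Injective fun (F : WMap A B u v) (n : ℤ) => totGen F n := by
  intro F G h
  funext m i j
  refine LinearMap.ext fun x => ?_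
  obtain ⟨n, rfl⟩ : ∃ n, j = n + i := ⟨j - i, by omega⟩
  obtain ⟨k, hk⟩ : ∃ k, i = k - u + m := ⟨i + u - m, by omega⟩
  have key := congrArg (fun t => (t n (totSingle A n i x)).1 k) h
  simp only [totGen_totSingle _ n i k m hk] at key
  have := congrArg (fun y => (Int.negOnePow (((m : ℤ) + u) * n) : ℤ) • y) key
  simp only [negOnePow_smul_negOnePow_smul] at this
  have := congrArg (B.cast (i' := i + (u - m)) (j' := n + i + (v - m)) (by omega) (by omega)) this
  simpa only [Bigraded.cast_cast, Bigraded.cast_self] using this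

/-- The element of `wbimod(A,B)_u^v` whose components are, up to sign, the matrix coefficients
of a graded map of totalizations. -/
def untot {A B : Bigraded R} {u v : ℤ} (g : ∀ n : ℤ, TotM A n →ₗ[R] TotM B (n + v - u)) :
    WMap A B u v := fun m i j =>
  (Int.negOnePow (((m : ℤ) + u) * (j - i)) : ℤ) •
    (B.cast (i := i + (u - m)) (j := j - i + v - u + (i + (u - m))) rfl (by ring)).comp
      ((LinearMap.proj (φ := fun k => B.M k (j - i + v - u + k)) (i + (u - m))).comp
        ((totCarrier B (j - i + v - u)).subtype.comp
          ((g (j - i)).comp ((totSingle A (j - i) i).comp (A.cast rfl (by ring))))))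

theorem untot_apply {A B : Bigraded R} {u v : ℤ}
    (g : ∀ n : ℤ, TotM A n →ₗ[R] TotM B (n + v - u)) (m : ℕ) (n i j k : ℤ) (hj : n + i = j)
    (hk : k = i + (u - m)) (x : A.M i (n + i)) :
    untot g m i j (A.cast rfl hj x) =
      (Int.negOnePow (((m : ℤ) + u) * n) : ℤ) •
        B.cast hk (by omega) ((g n (totSingle A n i x)).1 k) := by
  obtain rfl : n = j - i := by omega
  subst hk
  change (Int.negOnePow (((m : ℤ) + u) * (j - i)) : ℤ) •
    B.cast (i := i + (u - m)) (j := j - i + v - u + (i + (u - m))) (j' := j + (v - m)) rfl (by ring)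
    ((g (j - i) (totSingle A (j - i) i (A.cast rfl _ (A.cast rfl hj x)))).1 _) = _
  rw [Bigraded.cast_cast]
  rfl

theorem totGen_untot {A B : Bigraded R} {u v : ℤ}
    (g : ∀ n : ℤ, TotM A n →ₗ[R] TotM B (n + v - u))
    (hg : ∀ q n : ℤ, ∀ a ∈ totFilt A q n, g n a ∈ totFilt B (q + u) (n + v - u)) (n : ℤ) :
    totGen (untot g) n = g n := by
  refine LinearMap.ext fun a => Subtype.ext (funext fun k => ?_)
  obtain ⟨M, hM⟩ := a.exists_bound (k - u)
  have hterm (m : ℕ) : totTerm (untot g) n a.1 k m =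
      (g n (totSingle A n (k - u + m) (a.1 (k - u + m)))).1 k := by
    have h := untot_apply g m n (k - u + m) _ k rfl (by omega) (a.1 (k - u + m))
    change untot g m _ _ (a.1 (k - u + m)) = _ at h
    rw [totTerm, h, map_zsmul, negOnePow_smul_negOnePow_smul, Bigraded.cast_cast]
    rfl
  have hlow : a - ∑ m ∈ range M, totSingle A n (k - u + m) (a.1 (k - u + m)) ∈
      totFilt A (k - u - 1) n := by
    intro i hi
    obtain ⟨m, rfl⟩ : ∃ m : ℕ, i = k - u + m := ⟨(i - (k - u)).toNat, by omega⟩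
    rw [Submodule.coe_sub, Pi.sub_apply, Submodule.coe_sum, Finset.sum_apply]
    by_cases hm : m ∈ range M
    · rw [Finset.sum_eq_single_of_mem m hm fun m' _ hm' =>
        totSingle_of_ne A n (by omega) _, totSingle_same, sub_self]
    · rw [Finset.sum_eq_zero fun m' hm' => totSingle_of_ne A n
        (fun h => hm (by rwa [show m = m' by omega])) _, sub_zero]
      exact hM _ (by have := mem_range.not.mp hm; omega)
  have hzero := hg _ _ _ hlow k (by omega)
  rw [map_sub, Submodule.coe_sub, Pi.sub_apply, map_sum, Submodule.coe_sum, Finset.sum_apply,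
    sub_eq_zero] at hzero
  rw [totGen_apply_eq_sum _ _ _ _ M hM, hzero]
  exact Finset.sum_congr rfl fun m _ => hterm m

theorem bijOn_totGen (A B : Bigraded R) (u v : ℤ) :
    Set.BijOn (fun (F : WMap A B u v) (n : ℤ) => totGen F n) Set.univ
      {g | ∀ q n : ℤ, ∀ a ∈ totFilt A q n, g n a ∈ totFilt B (q + u) (n + v - u)} :=
  ⟨fun F _ _ _ _ ha => totGen_mem_totFilt F ha, totGen_injective.injOn,
    fun g hg => ⟨untot g, Set.mem_univ _, funext (totGen_untot g hg)⟩⟩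

/-- The contribution of `f_i g_j` to the `k`-th component of `Tot(c(f,g))(a)`. -/
def totCompTerm {A B C : Bigraded R} {u v u' v' : ℤ} (f : WMap B C u v) (g : WMap A B u' v')
    (n : ℤ) (a : ∀ i : ℤ, A.M i (n + i)) (k : ℤ) (i j : ℕ) :
    C.M k (n + (v + v') - (u + u') + k) :=
  (Int.negOnePow ((i + j + (u + u')) * n + i * (v' - u')) : ℤ) •
    C.cast (by ring) (by ring)
      (f i _ _ (g j (k - (u + u') + (i + j)) (n + (k - (u + u') + (i + j)))
        (a (k - (u + u') + (i + j)))))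

theorem cast_comp_apply {A B C : Bigraded R} {p q p' q' : ℤ} (f : GMap B C p q)
    (g : GMap A B p' q') {n : ℤ} (a : ∀ i : ℤ, A.M i (n + i)) {r s t t' k l : ℤ} (ht : t = t')
    (hr' : t' + p' = r) (hs' : n + t' + q' = s)
    (hk : r + p = k) (hl : s + q = l) (hk' : t + p' + p = k) (hl' : n + t + q' + q = l) :
    C.cast hk hl (f r s (B.cast hr' hs' (g t' (n + t') (a t')))) =
      C.cast hk' hl' (f _ _ (g t (n + t) (a t))) := by
  subst ht
  rw [GMap.apply_cast, Bigraded.cast_cast]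

theorem totTerm_wcomp {A B C : Bigraded R} {u v u' v' : ℤ} (f : WMap B C u v)
    (g : WMap A B u' v') (n : ℤ) (a : ∀ i : ℤ, A.M i (n + i)) (k : ℤ) (m : ℕ) :
    totTerm (wcomp f g) n a k m =
      ∑ ij ∈ antidiagonal m, totCompTerm f g n a k ij.1 ij.2 := by
  rw [← Finset.sum_attach, totTerm, wcomp]
  simp only [Finset.sum_apply, LinearMap.sum_apply, map_sum, Finset.smul_sum]
  refine Finset.sum_congr rfl fun ⟨⟨i, j⟩, hij⟩ _ => ?_
  obtain rfl := mem_antidiagonal.mp hij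
  simp only [Pi.smul_apply, LinearMap.smul_apply, map_zsmul, grecast, gcomp,
    LinearMap.comp_apply, Bigraded.cast_cast, smul_smul, totCompTerm]
  rw [← Units.val_mul, ← Int.negOnePow_add]
  push_cast
  rfl

theorem totTerm_totGen {A B C : Bigraded R} {u v u' v' : ℤ} (f : WMap B C u v)
    (g : WMap A B u' v') (n : ℤ) (a : TotM A n) (k : ℤ) (i M : ℕ)
    (hM : ∀ l : ℤ, k - (u + u') + (i + M) ≤ l → a.1 l = 0) :
    totTerm f (n + v' - u') (totGen g n a).1 k i =
      (Int.negOnePow (u * (v' - u')) : ℤ) •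
        C.cast rfl (by ring) (∑ j ∈ range M, totCompTerm f g n a.1 k i j) := by
  rw [totTerm, totGen_apply_eq_sum g n a _ M fun l hl => hM l (by omega)]
  simp only [map_sum, Finset.smul_sum]
  refine Finset.sum_congr rfl fun j _ => ?_
  simp only [totTerm, totCompTerm, map_zsmul, Bigraded.cast_cast, smul_smul]
  rw [cast_comp_apply (f i) (g j) a.1
      (show k - (u + u') + (i + j) = k - u + i - u' + j by ring)
      (hk' := by ring) (hl' := by ring),
    ← Units.val_mul, ← Units.val_mul, ← Int.negOnePow_add, ← Int.negOnePow_add]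
  congr 3
  ring

theorem totGen_wcomp {A B C : Bigraded R} {u v u' v' : ℤ} (f : WMap B C u v)
    (g : WMap A B u' v') (n : ℤ) :
    totGen (wcomp f g) n =
      (Int.negOnePow (u * (v' - u')) : ℤ) •
        (totCastL C (by ring)).comp ((totGen f (n + v' - u')).comp (totGen g n)) := by
  refine LinearMap.ext fun a => Subtype.ext (funext fun k => ?_)
  obtain ⟨M, hM⟩ := a.exists_bound (k - (u + u'))
  change _ = (Int.negOnePow (u * (v' - u')) : ℤ) • (totCastL C _ (totGen f _ (totGen g n a))).1 k
  rw [totCastL_apply, totGen_apply_eq_sum _ _ _ _ M hM,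
    totGen_apply_eq_sum f _ (totGen g n a) k M fun l hl =>
      finsum_eq_zero_of_forall_eq_zero fun j => totTerm_eq_zero _ _ _ _ _ (hM _ (by omega))]
  simp only [totTerm_wcomp, Finset.Nat.sum_antidiagonal_eq_sum_range_succ_mk]
  rw [Finset.sum_range_diag_flip M (totCompTerm f g n a.1 k), map_sum, Finset.smul_sum]
  refine Finset.sum_congr rfl fun i hi => ?_
  rw [totTerm_totGen f g n a k i (M - i) fun l hl =>
      hM l (by have := mem_range.mp hi; omega),
    map_zsmul, negOnePow_smul_negOnePow_smul, Bigraded.cast_cast]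
  rfl

theorem totGen_wdelta {A B : Bigraded R} (dA : WMap A A 0 1) (dB : WMap B B 0 1) {u v : ℤ}
    (F : WMap A B u v) (n : ℤ) :
    totGen (wdelta dA dB F) n =
      (totCastL B (by ring)).comp ((totDW dB (n + v - u)).comp (totGen F n))
      - (Int.negOnePow (v - u) : ℤ) •
        (totCastL B (by ring)).comp ((totGen F (n + 1)).comp (totDW dA n)) := by
  rw [wdelta, totGen_sub, totGen_zsmul]
  refine LinearMap.ext fun a => ?_
  simp only [LinearMap.sub_apply, LinearMap.smul_apply, LinearMap.comp_apply, totGen_wrecast,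
    totGen_wcomp, totDW, totGen_totCastL, map_zsmul, totCastL_totCastL, smul_smul]
  rw [← Units.val_mul, ← Int.negOnePow_add, Int.negOnePow_sub]
  simp [Int.negOnePow_add]

/-- **Statement 13.** Totalization of `wbimod`-elements of arbitrary bidegree `(u,v)`:
(i) `Tot(F)` shifts the column filtration by `u` (and the degree by `v - u`);
(ii) `F ↦ Tot(F)` is a bijection from `wbimod(A,B)_u^v` onto the filtered maps of
filtration-shift `u` and degree `v-u`; (iii) `Tot(c(f,g)) = (-1)^{u_f |g|} Tot(f) ∘ Tot(g)`;
(iv) `Tot(δ(F)) = d ∘ Tot(F) - (-1)^{|F|} Tot(F) ∘ d`.  Consequently totalization is an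
isomorphism of `vbic`-enriched categories from twisted complexes onto split filtered
complexes. -/
theorem tot_enriched_isomorphism {R : Type} [CommRing R] (A B C : TwComplex R) :
    -- (i) filtration shift
    (∀ (u v : ℤ) (F : WMap A.toBigraded B.toBigraded u v) (q n : ℤ),
        ∀ a ∈ totFilt A.toBigraded q n,
          totGen F n a ∈ totFilt B.toBigraded (q + u) (n + v - u)) ∧
    -- (ii) bijectivity onto filtered maps
    (∀ u v : ℤ,
      Set.BijOn (fun (F : WMap A.toBigraded B.toBigraded u v) => fun n : ℤ => totGen F n)
        Set.univ
        {g : ∀ n : ℤ, TotM A.toBigraded n →ₗ[R] TotM B.toBigraded (n + v - u) |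
          ∀ q n : ℤ, ∀ a ∈ totFilt A.toBigraded q n,
            g n a ∈ totFilt B.toBigraded (q + u) (n + v - u)}) ∧
    -- (iii) compatibility with composition
    (∀ (u v u' v' : ℤ) (f : WMap B.toBigraded C.toBigraded u v)
        (g : WMap A.toBigraded B.toBigraded u' v') (n : ℤ),
        totGen (wcomp f g) n =
          (Int.negOnePow (u * (v' - u')) : ℤ) •
            (totCastL C.toBigraded (by ring)).comp
              ((totGen f (n + v' - u')).comp (totGen g n))) ∧
    -- (iv) compatibility with the differentials
    (∀ (u v : ℤ) (F : WMap A.toBigraded B.toBigraded u v) (n : ℤ),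
        totGen (wdelta A.d B.d F) n =
          (totCastL B.toBigraded (by ring)).comp
            ((totDW B.d (n + v - u)).comp (totGen F n))
          - (Int.negOnePow (v - u) : ℤ) •
            (totCastL B.toBigraded (by ring)).comp
              ((totGen F (n + 1)).comp (totDW A.d n))) := by
  exact ⟨fun u v F q n a ha => totGen_mem_totFilt F ha, fun u v => bijOn_totGen _ _ u v,
    fun u v u' v' f g n => totGen_wcomp f g n, fun u v F n => totGen_wdelta _ _ F n⟩
end
end

section
/- Let (A, m_{ij}) be a dA∞-algebra over R and r ≥ 0. The strict morphism ι_A : A → P_r(A), x ↦ (x, 0, x), is an r-homotopy equivalence: ∂⁻_A∘ι_A = 1_A, and ι_A∘∂⁻_A is r-homotopic to 1_{P_r(A)}. Explicitly, the map Δ : Λ_r → Λ_r⊗Λ_r defined by Δ(e₋) = e₋⊗(e₋+e₊) + e₊⊗e₋, Δ(e₊) = e₊⊗e₊, Δ(u) = u⊗e₊ + e₊⊗u is a strict morphism of twisted dgas satisfying (∂⁺⊗1)∘Δ = id and (∂⁻⊗1)∘Δ = ι∘∂⁻, so that Δ⊗1_A : P_r(A) → P_r(P_r(A)) is an r-homotopy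 from ι_A∘∂⁻_A to the identity of P_r(A). -/
open Finset

noncomputable section

variable {R : Type} [CommRing R]

/-! ## The `r`-path of a twisted complex -/

/-- Underlying bigraded module of the `r`-path: `P_r(A)_i^j = A_i^j ⊕ A_{i+r}^{j+r-1} ⊕ A_i^j`. -/
def pathBG (r : ℕ) (A : Bigraded R) : Bigraded R where
  M i j := A.M i j × (A.M (i + r) (j + r - 1) × A.M i j)
  acg := fun _ _ => inferInstance
  mod := fun _ _ => inferInstance

/-- First projection of the path. -/
def pp1 (r : ℕ) (A : Bigraded R) (i j : ℤ) : (pathBG r A).M i j →ₗ[R] A.M i j :=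
  LinearMap.fst R (A.M i j) (A.M (i + r) (j + r - 1) × A.M i j)

/-- Middle projection of the path. -/
def pp2 (r : ℕ) (A : Bigraded R) (i j : ℤ) : (pathBG r A).M i j →ₗ[R] A.M (i + r) (j + r - 1) :=
  (LinearMap.fst R (A.M (i + r) (j + r - 1)) (A.M i j)).comp
    (LinearMap.snd R (A.M i j) (A.M (i + r) (j + r - 1) × A.M i j))

/-- Last projection of the path. -/
def pp3 (r : ℕ) (A : Bigraded R) (i j : ℤ) : (pathBG r A).M i j →ₗ[R] A.M i j :=
  (LinearMap.snd R (A.M (i + r) (j + r - 1)) (A.M i j)).comp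
    (LinearMap.snd R (A.M i j) (A.M (i + r) (j + r - 1) × A.M i j))

/-- The structure maps `D_m` of the `r`-path:
`D_r(x,y,z) = (d_r x, -x - d_r y + z, d_r z)` and
`D_m(x,y,z) = (d_m x, (-1)^{m+r+1} d_m y, d_m z)` for `m ≠ r`. -/
def pathDRaw (r : ℕ) {A : Bigraded R} (d : WMap A A 0 1) :
    WMap (pathBG r A) (pathBG r A) 0 1 :=
  fun m i j =>
    LinearMap.prod
      ((d m i j).comp (pp1 r A i j))
      (LinearMap.prod
        (if h : m = r then
          - (A.cast (by omega) (by omega)).comp (pp1 r A i j)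
          - (A.cast (by ring) (by ring)).comp ((d m (i + r) (j + r - 1)).comp (pp2 r A i j))
          + (A.cast (by omega) (by omega)).comp (pp3 r A i j)
        else
          ((-1 : ℤ) ^ (m + r + 1)) •
            (A.cast (by ring) (by ring)).comp ((d m (i + r) (j + r - 1)).comp (pp2 r A i j)))
        ((d m i j).comp (pp3 r A i j)))

/-- `∂⁻ : P_r(A) → A`, `(x,y,z) ↦ x`, as a graded map of bidegree `(0,0)`. -/
def projMinusG (r : ℕ) (A : Bigraded R) : GMap (pathBG r A) A 0 0 :=
  fun i j => (A.cast (by ring) (by ring)).comp (pp1 r A i j)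

/-- `∂⁺ : P_r(A) → A`, `(x,y,z) ↦ z`, as a graded map of bidegree `(0,0)`. -/
def projPlusG (r : ℕ) (A : Bigraded R) : GMap (pathBG r A) A 0 0 :=
  fun i j => (A.cast (by ring) (by ring)).comp (pp3 r A i j)

/-- `∂⁰ : P_r(A) → A`, `(x,y,z) ↦ y`, of bidegree `(r, r-1)`. -/
def proj0G (r : ℕ) (A : Bigraded R) : GMap (pathBG r A) A (r : ℤ) ((r : ℤ) - 1) :=
  fun i j => (A.cast (by ring) (by ring)).comp (pp2 r A i j)

/-- `∂⁻` as a strict morphism (family). -/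
def projMinusW (r : ℕ) (A : Bigraded R) : WMap (pathBG r A) A 0 0 := strictW (projMinusG r A)

/-- `∂⁺` as a strict morphism (family). -/
def projPlusW (r : ℕ) (A : Bigraded R) : WMap (pathBG r A) A 0 0 := strictW (projPlusG r A)

/-- `ι : A → P_r(A)`, `x ↦ (x,0,x)`, as a graded map of bidegree `(0,0)`. -/
def iotaG (r : ℕ) (A : Bigraded R) : GMap A (pathBG r A) 0 0 :=
  fun i j => LinearMap.prod (A.cast (by ring) (by ring))
    (LinearMap.prod 0 (A.cast (by ring) (by ring)))

/-- `ι` as a strict morphism (family). -/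
def iotaW (r : ℕ) (A : Bigraded R) : WMap A (pathBG r A) 0 0 := strictW (iotaG r A)

/-- An `r`-homotopy from `f` to `g`: a morphism of twisted complexes `h : A → P_r(B)` with
`∂⁻ ∘ h = f` and `∂⁺ ∘ h = g`. -/
def IsRHomotopy (r : ℕ) {A B : Bigraded R} (dA : WMap A A 0 1) (dB : WMap B B 0 1)
    (f g : WMap A B 0 0) (h : WMap A (pathBG r B) 0 0) : Prop :=
  IsTwMor dA (pathDRaw r dB) h ∧ compFam (projMinusW r B) h = f ∧
    compFam (projPlusW r B) h = g

/-- `f` and `g` are `r`-homotopic. -/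
def RHomotopic (r : ℕ) {A B : Bigraded R} (dA : WMap A A 0 1) (dB : WMap B B 0 1)
    (f g : WMap A B 0 0) : Prop :=
  ∃ h, IsRHomotopy r dA dB f g h

/-- The equivalent description of an `r`-homotopy from `f` to `g` as a family of maps
`ĥ_m : A → B` of bidegree `(-m+r, -m+r-1)` satisfying the relations `(H_{m1})`. -/
def IsHtpFam (r : ℕ) {A B : Bigraded R} (dA : WMap A A 0 1) (dB : WMap B B 0 1)
    (f g : WMap A B 0 0) (hh : WMap A B (r : ℤ) ((r : ℤ) - 1)) : Prop :=
  ∀ m : ℕ,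
    (∑ ij ∈ (antidiagonal m).attach,
      (((-1 : ℤ) ^ (ij.1.1 + r)) •
        grecast ((r : ℤ) - m) ((r : ℤ) - m)
          (by have := mem_antidiagonal.mp ij.2; omega)
          (by have := mem_antidiagonal.mp ij.2; omega)
          (gcomp (dB ij.1.1) (hh ij.1.2))
      + ((-1 : ℤ) ^ ij.1.1) •
        grecast ((r : ℤ) - m) ((r : ℤ) - m)
          (by have := mem_antidiagonal.mp ij.2; omega)
          (by have := mem_antidiagonal.mp ij.2; omega)
          (gcomp (hh ij.1.1) (dA ij.1.2))))
    = if hm : r ≤ m then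
        grecast ((r : ℤ) - m) ((r : ℤ) - m) (by omega) (by omega) (g (m - r) - f (m - r))
      else 0

/-- `f` is an `r`-homotopy equivalence. -/
def IsRHomotopyEquiv (r : ℕ) {A B : Bigraded R} (dA : WMap A A 0 1) (dB : WMap B B 0 1)
    (f : WMap A B 0 0) : Prop :=
  ∃ g : WMap B A 0 0, IsTwMor dB dA g ∧
    RHomotopic r dB dB (compFam f g) (idW B) ∧
    RHomotopic r dA dA (compFam g f) (idW A)

/-! ## Graded multilinear operations and derived A∞-algebras -/

/-- "Cast or zero": transport along an equality of bidegrees if it holds, zero otherwise. -/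
def c0 (A : Bigraded R) {i j i' j' : ℤ} : A.M i j →ₗ[R] A.M i' j' :=
  if h : i = i' ∧ j = j' then A.cast h.1 h.2 else 0

/-- Graded multilinear operations `A^{⊗k} → B` of bidegree `(p,q)`: for each coloring
`c : Fin k → ℤ × ℤ` of the inputs, a multilinear map to the component of total bidegree
`(∑ c) + (p,q)`. -/
abbrev GMulti (A B : Bigraded R) (k : ℕ) (p q : ℤ) : Type :=
  ∀ c : Fin k → ℤ × ℤ,
    MultilinearMap R (fun l => A.M (c l).1 (c l).2)
      (B.M ((∑ l, (c l).1) + p) ((∑ l, (c l).2) + q))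

/-- Arity cast-or-zero for graded multilinear operations. -/
def gmC0 {A B : Bigraded R} {p q : ℤ} {k : ℕ} (k' : ℕ) (M : GMulti A B k p q) :
    GMulti A B k' p q :=
  if h : k = k' then h ▸ M else 0

/-- The evaluation of the composite `Mo ∘ (1^{⊗r} ⊗ N ⊗ 1^{⊗t})` (with the Koszul sign rule)
on a colored tuple. -/
def insEval {A B : Bigraded R} {p q pN qN : ℤ} {kIn : ℕ} (r t : ℕ)
    (Mo : GMulti A B (r + 1 + t) p q) (N : GMulti A A kIn pN qN)
    (c : Fin (r + kIn + t) → ℤ × ℤ) (a : ∀ l, A.M (c l).1 (c l).2) :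
    B.M ((∑ l, (c l).1) + (p + pN)) ((∑ l, (c l).2) + (q + qN)) :=
  let cIn : Fin kIn → ℤ × ℤ := fun l => c ⟨r + l, by have := l.isLt; omega⟩
  let w : ℤ × ℤ := ((∑ l, (cIn l).1) + pN, (∑ l, (cIn l).2) + qN)
  let c' : Fin (r + 1 + t) → ℤ × ℤ := fun l =>
    if h : (l : ℕ) < r then c ⟨l, by have := l.isLt; omega⟩
    else if h' : (l : ℕ) = r then w
    else c ⟨(l : ℕ) + kIn - 1, by have := l.isLt; omega⟩
  let a' : ∀ l, A.M (c' l).1 (c' l).2 := fun l =>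
    if h : (l : ℕ) < r then
      c0 A (a ⟨l, by have := l.isLt; omega⟩)
    else if h' : (l : ℕ) = r then
      c0 A (N cIn (fun l' => a ⟨r + l', by have := l'.isLt; omega⟩))
    else c0 A (a ⟨(l : ℕ) + kIn - 1, by have := l.isLt; omega⟩)
  (Int.negOnePow (pN * (∑ l : Fin r, (c ⟨l, by have := l.isLt; omega⟩).1)
      + qN * (∑ l : Fin r, (c ⟨l, by have := l.isLt; omega⟩).2)) : ℤ) •
    c0 B (Mo c' a')

/-- The index set of the relation `(A_{uv})`: triples `(i, r, q)` with `i ≤ u`, `1 ≤ q`,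
`r + q ≤ v` (and `p := u - i`, `t := v - q - r`, `j := r + 1 + t`). -/
def dAIdx (u v : ℕ) : Finset (ℕ × ℕ × ℕ) :=
  ((Finset.range (u + 1)) ×ˢ (Finset.range (v + 1)) ×ˢ (Finset.Icc 1 v)).filter
    fun x => x.2.1 + x.2.2 ≤ v

theorem dAIdx_spec {u v : ℕ} {x : ℕ × ℕ × ℕ} (hx : x ∈ dAIdx u v) :
    x.1 ≤ u ∧ 1 ≤ x.2.2 ∧ x.2.1 + x.2.2 ≤ v := by
  obtain ⟨h1, h2⟩ := Finset.mem_filter.mp hx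
  have h3 := Finset.mem_product.mp h1
  have h4 := Finset.mem_product.mp h3.2
  have h5 := Finset.mem_range.mp h3.1
  have h6 := Finset.mem_Icc.mp h4.2
  exact ⟨by omega, h6.1, h2⟩

/-- The relation `(A_{uv})` of a derived `A∞`-algebra, in evaluated form:
`∑ (-1)^{rq+t+pj} m_{ij}(1^{⊗r} ⊗ m_{pq} ⊗ 1^{⊗t}) = 0` (sum over `i+p = u`,
`j+q-1 = v`, `j = 1+r+t`). -/
def dAinfRel (A : Bigraded R) (m : ∀ i k : ℕ, GMulti A A k (-(i : ℤ)) (2 - i - k))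
    (u v : ℕ) : Prop :=
  ∀ (c : Fin v → ℤ × ℤ) (a : ∀ l, A.M (c l).1 (c l).2),
    (∑ x ∈ (dAIdx u v).attach,
      ((-1 : ℤ) ^ (x.1.2.1 * x.1.2.2 + (v - x.1.2.2 - x.1.2.1)
          + (u - x.1.1) * (x.1.2.1 + 1 + (v - x.1.2.2 - x.1.2.1)))) •
        (c0 A (insEval x.1.2.1 (v - x.1.2.2 - x.1.2.1)
          (m x.1.1 (x.1.2.1 + 1 + (v - x.1.2.2 - x.1.2.1)))
          (m (u - x.1.1) x.1.2.2)
          (fun l => c (Fin.cast (by have := dAIdx_spec x.2; omega) l))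
          (fun l => a (Fin.cast (by have := dAIdx_spec x.2; omega) l)))
        : A.M ((∑ l, (c l).1) - u) ((∑ l, (c l).2) + (3 - (u : ℤ) - v))))
      = 0

/-- A derived `A∞`-algebra structure: operations `m_{ij} : A^{⊗j} → A` of bidegree
`(-i, 2-i-j)` satisfying the relations `(A_{uv})` for all `u ≥ 0`, `v ≥ 1`. -/
def IsdAInf (A : Bigraded R) (m : ∀ i k : ℕ, GMulti A A k (-(i : ℤ)) (2 - i - k)) : Prop :=
  ∀ u v : ℕ, 1 ≤ v → dAinfRel A m u v

/-- A twisted dga: the only (possibly) non-zero operations are `μ_{i1}` and `μ_{02}`. -/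
def IsTwistedDga (A : Bigraded R) (m : ∀ i k : ℕ, GMulti A A k (-(i : ℤ)) (2 - i - k)) :
    Prop :=
  IsdAInf A m ∧ ∀ i k : ℕ, ¬(k = 1 ∨ (i = 0 ∧ k = 2)) → m i k = 0

/-- The iterated products `μ_n` of a twisted dga : `μ_2 = μ_{02}`,
`μ_{n+1} = μ_{02} ∘ (μ_n ⊗ 1)`. -/
def IsMuIter (A : Bigraded R) (m : ∀ i k : ℕ, GMulti A A k (-(i : ℤ)) (2 - i - k))
    (mu : ∀ n : ℕ, GMulti A A n 0 0) : Prop :=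
  (∀ (c : Fin 2 → ℤ × ℤ) (a : ∀ l, A.M (c l).1 (c l).2),
      mu 2 c a = c0 A (m 0 2 c a)) ∧
  (∀ n : ℕ, 2 ≤ n → ∀ (c : Fin (n + 1) → ℤ × ℤ) (a : ∀ l, A.M (c l).1 (c l).2),
      mu (n + 1) c a = c0 A (insEval 0 1 (m 0 2) (mu n)
        (fun l => c (Fin.cast (by omega) l)) (fun l => a (Fin.cast (by omega) l))))

/-! ## Unary operations, path structures, morphisms and homotopies of derived A∞-algebras -/

/-- Convert a family of bidegree-`(p,q)` linear maps into an arity-one graded operation. -/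
def toGM1 {A B : Bigraded R} {p q : ℤ}
    (g : ∀ i j : ℤ, A.M i j →ₗ[R] B.M (i + p) (j + q)) : GMulti A B 1 p q :=
  fun c =>
    ((MultilinearMap.ofSubsingleton R (A.M (c 0).1 (c 0).2)
        (B.M ((∑ l, (c l).1) + p) ((∑ l, (c l).2) + q)) (0 : Fin 1))
      ((c0 B).comp (g (c 0).1 (c 0).2))).compLinearMap
      (fun _ => c0 A)

/-- Convert an arity-one graded operation into a family of linear maps. -/
def fromGM1 {A B : Bigraded R} {p q : ℤ} (M : GMulti A B 1 p q) (i j : ℤ) :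
    A.M i j →ₗ[R] B.M (i + p) (j + q) :=
  (c0 B).comp ((MultilinearMap.ofSubsingleton R (A.M i j)
    (B.M ((∑ l : Fin 1, ((fun _ : Fin 1 => ((i : ℤ), (j : ℤ))) l).1) + p)
      ((∑ l : Fin 1, ((fun _ : Fin 1 => ((i : ℤ), (j : ℤ))) l).2) + q)) (0 : Fin 1)).symm
    (M (fun _ => (i, j))))

/-- The unary operations `M_{i1}` of the `r`-path of a derived `A∞`-algebra:
`M_{r1}(x,y,z) = (m_{r1}x, -x - m_{r1}y + z, m_{r1}z)` and
`M_{i1}(x,y,z) = (m_{i1}x, (-1)^{i+r+1} m_{i1}y, m_{i1}z)` for `i ≠ r`. -/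
def pathD1 (r : ℕ) {A : Bigraded R}
    (m : ∀ i k : ℕ, GMulti A A k (-(i : ℤ)) (2 - i - k)) (i : ℕ) (a b : ℤ) :
    (pathBG r A).M a b →ₗ[R]
      (pathBG r A).M (a + (-(i : ℤ))) (b + (2 - (i : ℤ) - 1)) :=
  LinearMap.prod
    ((c0 A).comp ((fromGM1 (m i 1) a b).comp (pp1 r A a b)))
    (LinearMap.prod
      (if h : i = r then
        - (c0 A).comp (pp1 r A a b)
        - (c0 A).comp ((fromGM1 (m i 1) (a + r) (b + r - 1)).comp (pp2 r A a b))
        + (c0 A).comp (pp3 r A a b)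
      else
        ((-1 : ℤ) ^ (i + r + 1)) •
          (c0 A).comp ((fromGM1 (m i 1) (a + r) (b + r - 1)).comp (pp2 r A a b)))
      ((c0 A).comp ((fromGM1 (m i 1) a b).comp (pp3 r A a b))))

/-- The higher operations `M_{ij} = diag(m_{ij}, (-1)^{rj+i+j} m_{ij}, m_{ij}) ∘ t_j`
(`j ≥ 2`) of the `r`-path, evaluated per coloring. -/
def pathDHigher (r : ℕ) {A : Bigraded R}
    (m : ∀ i k : ℕ, GMulti A A k (-(i : ℤ)) (2 - i - k)) (i k : ℕ)
    (c : Fin k → ℤ × ℤ) :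
    MultilinearMap R (fun l => (pathBG r A).M (c l).1 (c l).2)
      ((pathBG r A).M ((∑ l, (c l).1) + (-(i : ℤ))) ((∑ l, (c l).2) + (2 - i - k))) :=
  MultilinearMap.prod
    ((m i k c).compLinearMap (fun l => pp1 r A (c l).1 (c l).2))
    (MultilinearMap.prod
      (((-1 : ℤ) ^ (r * k + i + k)) •
        ∑ kk : Fin k,
          (c0 A).compMultilinearMap
            ((m i k (fun l => if l = kk then ((c l).1 + r, (c l).2 + r - 1) else c l)).compLinearMap
              (fun l =>
                if l = kk then (c0 A).comp (pp2 r A (c l).1 (c l).2)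
                else if (l : ℕ) < (kk : ℕ) then
                  (c0 A).comp
                    ((Int.negOnePow ((r : ℤ) * (c l).1 + (1 - (r : ℤ)) * (c l).2) : ℤ) •
                      pp1 r A (c l).1 (c l).2)
                else (c0 A).comp (pp3 r A (c l).1 (c l).2))))
      ((m i k c).compLinearMap (fun l => pp3 r A (c l).1 (c l).2)))

/-- The full family of operations of the `r`-path of a derived `A∞`-algebra. -/
def pathOps (r : ℕ) {A : Bigraded R}
    (m : ∀ i k : ℕ, GMulti A A k (-(i : ℤ)) (2 - i - k)) :
    ∀ i k : ℕ, GMulti (pathBG r A) (pathBG r A) k (-(i : ℤ)) (2 - i - k) :=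
  fun i k =>
    if h1 : k = 1 then by
      subst h1; exact toGM1 (pathD1 r m i)
    else if h2 : 2 ≤ k then fun c => pathDHigher r m i k c
    else 0

/-- Evaluation of the composite `Mo ∘ (G_1 ⊗ ⋯ ⊗ G_j)` (with the Koszul sign rule) of an
outer `j`-ary operation with `j` block operations of sizes `qs` on a colored `v`-tuple. -/
def blockEval {A B C : Bigraded R} {pM qM : ℤ} (j v : ℕ) (qs : Fin j → ℕ)
    (Mo : GMulti B C j pM qM) (ps : Fin j → ℤ × ℤ)
    (G : ∀ s : Fin j, GMulti A B (qs s) (ps s).1 (ps s).2)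
    (c : Fin v → ℤ × ℤ) (a : ∀ l, A.M (c l).1 (c l).2) :
    C.M ((∑ l, (c l).1) + (pM + ∑ s, (ps s).1)) ((∑ l, (c l).2) + (qM + ∑ s, (ps s).2)) :=
  let cPad : ℕ → ℤ × ℤ := fun n => if h : n < v then c ⟨n, h⟩ else 0
  let aPad : ∀ n : ℕ, A.M (cPad n).1 (cPad n).2 := fun n =>
    if h : n < v then c0 A (a ⟨n, h⟩) else 0
  let off : Fin j → ℕ := fun s => ∑ s' : Fin j, if (s' : ℕ) < (s : ℕ) then qs s' else 0
  let cIn : ∀ s : Fin j, Fin (qs s) → ℤ × ℤ := fun s l => cPad (off s + l)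
  let val : ∀ s : Fin j,
      B.M ((∑ l, (cIn s l).1) + (ps s).1) ((∑ l, (cIn s l).2) + (ps s).2) :=
    fun s => G s (cIn s) (fun l => aPad (off s + l))
  let c' : Fin j → ℤ × ℤ :=
    fun s => ((∑ l, (cIn s l).1) + (ps s).1, (∑ l, (cIn s l).2) + (ps s).2)
  let sgn : ℤ := ∑ s' : Fin j, ∑ s : Fin j,
    if (s : ℕ) < (s' : ℕ) then
      (ps s').1 * (∑ l, (cIn s l).1) + (ps s').2 * (∑ l, (cIn s l).2)
    else 0
  (Int.negOnePow sgn : ℤ) • c0 C (Mo c' val)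

/-- The relations `(B_{uv})` for a morphism of derived `A∞`-algebras `f : A → B`. -/
def dAMorRel {A B : Bigraded R} (mA : ∀ i k : ℕ, GMulti A A k (-(i : ℤ)) (2 - i - k))
    (mB : ∀ i k : ℕ, GMulti B B k (-(i : ℤ)) (2 - i - k))
    (f : ∀ i k : ℕ, GMulti A B k (-(i : ℤ)) (1 - i - k)) (u v : ℕ) : Prop :=
  ∀ (c : Fin v → ℤ × ℤ) (a : ∀ l, A.M (c l).1 (c l).2),
    (∑ x ∈ (dAIdx u v).attach,
      ((-1 : ℤ) ^ (x.1.2.1 * x.1.2.2 + (v - x.1.2.2 - x.1.2.1)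
          + (u - x.1.1) * (x.1.2.1 + 1 + (v - x.1.2.2 - x.1.2.1)))) •
        (c0 B (insEval x.1.2.1 (v - x.1.2.2 - x.1.2.1)
          (f x.1.1 (x.1.2.1 + 1 + (v - x.1.2.2 - x.1.2.1)))
          (mA (u - x.1.1) x.1.2.2)
          (fun l => c (Fin.cast (by have := dAIdx_spec x.2; omega) l))
          (fun l => a (Fin.cast (by have := dAIdx_spec x.2; omega) l)))
        : B.M ((∑ l, (c l).1) - u) ((∑ l, (c l).2) + (2 - (u : ℤ) - v))))
    = ∑ i ∈ Finset.range (u + 1), ∑ j ∈ Finset.Icc 1 v,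
        ∑ qs ∈ (Finset.Nat.antidiagonalTuple j v).filter (fun qs => ∀ s, 1 ≤ qs s),
          ∑ ps ∈ Finset.Nat.antidiagonalTuple j (u - i),
            ((-1 : ℤ) ^ (u + ∑ s : Fin j, ((ps s + qs s) * (j + (s : ℕ) + 1)
                + qs s * (∑ w : Fin j, if (s : ℕ) < (w : ℕ) then ps w + qs w else 0)))) •
              c0 B (blockEval j v qs (mB i j)
                (fun s => (-(ps s : ℤ), 1 - (ps s : ℤ) - (qs s : ℤ)))
                (fun s => f (ps s) (qs s)) c a)

/-- A morphism of derived `A∞`-algebras: the relations `(B_{uv})` for all `u ≥ 0`, `v ≥ 1`. -/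
def IsdAMor {A B : Bigraded R} (mA : ∀ i k : ℕ, GMulti A A k (-(i : ℤ)) (2 - i - k))
    (mB : ∀ i k : ℕ, GMulti B B k (-(i : ℤ)) (2 - i - k))
    (f : ∀ i k : ℕ, GMulti A B k (-(i : ℤ)) (1 - i - k)) : Prop :=
  ∀ u v : ℕ, 1 ≤ v → dAMorRel mA mB f u v

/-- A strict morphism datum of derived `A∞`-algebras. -/
def strictM {A B : Bigraded R} (g : ∀ a b : ℤ, A.M a b →ₗ[R] B.M (a + 0) (b + 0)) :
    ∀ i k : ℕ, GMulti A B k (-(i : ℤ)) (1 - i - k) :=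
  fun i k =>
    if h : i = 0 ∧ k = 1 then by
      obtain ⟨h1, h2⟩ := h; subst h1; subst h2; exact toGM1 g
    else 0

/-- `h` is the composite `f ∘ g` of morphism data of derived `A∞`-algebras:
`(f∘g)_{uk} = ∑ (-1)^{σ} f_{ir}(g_{p₁q₁} ⊗ ⋯ ⊗ g_{p_rq_r})`. -/
def IsdAComp {A B C : Bigraded R}
    (g : ∀ i k : ℕ, GMulti A B k (-(i : ℤ)) (1 - i - k))
    (f : ∀ i k : ℕ, GMulti B C k (-(i : ℤ)) (1 - i - k))
    (h : ∀ i k : ℕ, GMulti A C k (-(i : ℤ)) (1 - i - k)) : Prop :=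
  ∀ u k : ℕ, 1 ≤ k → ∀ (c : Fin k → ℤ × ℤ) (a : ∀ l, A.M (c l).1 (c l).2),
    h u k c a
    = ∑ i ∈ Finset.range (u + 1), ∑ r ∈ Finset.Icc 1 k,
        ∑ qs ∈ (Finset.Nat.antidiagonalTuple r k).filter (fun qs => ∀ s, 1 ≤ qs s),
          ∑ ps ∈ Finset.Nat.antidiagonalTuple r (u - i),
            ((-1 : ℤ) ^ (∑ s : Fin r, ((ps s + qs s) * (r + (s : ℕ) + 1)
                + qs s * (∑ w : Fin r, if (s : ℕ) < (w : ℕ) then ps w + qs w else 0)))) •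
              c0 C (blockEval r k qs (f i r)
                (fun s => (-(ps s : ℤ), 1 - (ps s : ℤ) - (qs s : ℤ)))
                (fun s => g (ps s) (qs s)) c a)

/-- An `r`-homotopy between morphism data `f, g : A → B` of derived `A∞`-algebras:
a morphism `h : A → P_r(B)` with `∂⁻ ∘ h = f` and `∂⁺ ∘ h = g`. -/
def IsdAHomotopy (r : ℕ) {A B : Bigraded R}
    (mA : ∀ i k : ℕ, GMulti A A k (-(i : ℤ)) (2 - i - k))
    (mB : ∀ i k : ℕ, GMulti B B k (-(i : ℤ)) (2 - i - k))
    (f g : ∀ i k : ℕ, GMulti A B k (-(i : ℤ)) (1 - i - k))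
    (h : ∀ i k : ℕ, GMulti A (pathBG r B) k (-(i : ℤ)) (1 - i - k)) : Prop :=
  IsdAMor mA (pathOps r mB) h ∧
  IsdAComp h (strictM (projMinusG r B)) f ∧
  IsdAComp h (strictM (projPlusG r B)) g

/-- `r`-homotopy equivalence of derived `A∞`-algebras. -/
def IsdAHtpEquiv (r : ℕ) {A B : Bigraded R}
    (mA : ∀ i k : ℕ, GMulti A A k (-(i : ℤ)) (2 - i - k))
    (mB : ∀ i k : ℕ, GMulti B B k (-(i : ℤ)) (2 - i - k))
    (f : ∀ i k : ℕ, GMulti A B k (-(i : ℤ)) (1 - i - k)) : Prop :=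
  ∃ g, IsdAMor mB mA g ∧
    ∃ fg gf, IsdAComp g f fg ∧ IsdAComp f g gf ∧
      (∃ h, IsdAHomotopy r mB mB fg (strictM (idG B)) h) ∧
      (∃ h, IsdAHomotopy r mA mA gf (strictM (idG A)) h)

/-- The comultiplication `Δ ⊗ 1_A : P_r(A) → P_r(P_r(A))` in the triple presentation:
`(x,y,z) ↦ ((x,0,x), (0,0,y), (x,y,z))`, corresponding to
`Δ(e₋) = e₋ ⊗ (e₋+e₊) + e₊ ⊗ e₋`, `Δ(e₊) = e₊ ⊗ e₊`, `Δ(u) = u ⊗ e₊ + e₊ ⊗ u`. -/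
def DeltaMap (r : ℕ) (A : Bigraded R) (a b : ℤ) :
    (pathBG r A).M a b →ₗ[R] (pathBG r (pathBG r A)).M (a + 0) (b + 0) :=
  LinearMap.prod
    (LinearMap.prod ((c0 A).comp (pp1 r A a b))
      (LinearMap.prod 0 ((c0 A).comp (pp1 r A a b))))
    (LinearMap.prod
      (LinearMap.prod 0
        (LinearMap.prod 0 ((c0 A).comp (pp2 r A a b))))
      (LinearMap.prod ((c0 A).comp (pp1 r A a b))
        (LinearMap.prod ((c0 A).comp (pp2 r A a b)) ((c0 A).comp (pp3 r A a b)))))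

section CastOrZero

variable {A B C : Bigraded R}

@[simp]
theorem c0_self {i j : ℤ} (x : A.M i j) : (c0 A x : A.M i j) = x := by
  simp [c0, Bigraded.cast]

theorem cast_eq_c0 {i i' j j' : ℤ} (hi : i = i') (hj : j = j') :
    A.cast hi hj = c0 A := by
  simp [c0, hi, hj]

theorem c0_c0 {i j i' j' i'' j'' : ℤ} (hi : i = i') (hj : j = j') (x : A.M i j) :
    (c0 A (c0 A x : A.M i' j') : A.M i'' j'') = c0 A x := by
  subst hi hj
  simp

theorem GMap.c0_apply {p q : ℤ} (g : GMap A B p q) {i j i' j' x y : ℤ} (hi : i = i')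
    (hj : j = j') (a : A.M i j) :
    (c0 B (g i' j' (c0 A a)) : B.M x y) = c0 B (g i j a) := by
  subst hi hj
  simp

theorem GMulti.c0_apply {p q : ℤ} {k : ℕ} (M : GMulti A B k p q) {c c' : Fin k → ℤ × ℤ}
    (hc : ∀ l, c l = c' l) {x y : ℤ} (a : ∀ l, A.M (c l).1 (c l).2) :
    (c0 B (M c' fun l => c0 A (a l)) : B.M x y) = c0 B (M c a) := by
  obtain rfl : c = c' := funext hc
  simp

/-- The degree-preserving form of a graded map of recorded bidegree `(0,0)`. -/
def GMap.flat (g : GMap A B 0 0) (i j : ℤ) : A.M i j →ₗ[R] B.M i j :=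
  (c0 B).comp (g i j)

theorem GMap.c0_flat (g : GMap A B 0 0) {i j x y : ℤ} (a : A.M i j) :
    (c0 B (g.flat i j a) : B.M x y) = c0 B (g i j a) :=
  c0_c0 (by simp) (by simp) _

theorem toGM1_apply {p q : ℤ} (g : GMap A B p q) (c : Fin 1 → ℤ × ℤ)
    (a : ∀ l, A.M (c l).1 (c l).2) :
    toGM1 g c a = c0 B (g (c 0).1 (c 0).2 (a 0)) := by
  simp [toGM1]

theorem fromGM1_apply {p q : ℤ} (M : GMulti A B 1 p q) (i j : ℤ) (a : A.M i j) :
    fromGM1 M i j a = c0 B (M (fun _ => (i, j)) fun _ => a) := by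
  rfl

end CastOrZero

section Strict

variable {A B C : Bigraded R}

theorem strictM_zero_one (g : GMap A B 0 0) (c : Fin 1 → ℤ × ℤ)
    (a : ∀ l, A.M (c l).1 (c l).2) :
    strictM g 0 1 c a = c0 B (g (c 0).1 (c 0).2 (a 0)) := by
  exact toGM1_apply g c a

theorem strictM_of_not (g : GMap A B 0 0) {i k : ℕ} (h : ¬(i = 0 ∧ k = 1)) :
    strictM g i k = 0 := by
  simp only [strictM, h, dite_false]

theorem insEval_strictM (g : GMap A B 0 0) {kIn t : ℕ} {pN qN : ℤ} (N : GMulti A A kIn pN qN)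
    (ht : t = 0) (c : Fin (0 + kIn + t) → ℤ × ℤ) (a : ∀ l, A.M (c l).1 (c l).2) {x y : ℤ} :
    (c0 B (insEval 0 t (strictM g 0 (0 + 1 + t)) N c a) : B.M x y)
      = c0 B (g _ _ (N (fun l : Fin kIn => c (Fin.cast (by omega) l))
          fun l => a (Fin.cast (by omega) l))) := by
  subst ht
  have key : ∀ (c' : Fin 1 → ℤ × ℤ) (a' : ∀ l, A.M (c' l).1 (c' l).2) (i j : ℤ)
      (b : A.M i j), i = (c' 0).1 → j = (c' 0).2 → a' 0 = c0 A b →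
      ∀ {x' y' : ℤ}, (∑ l, (c' l).1) + 0 = x' → (∑ l, (c' l).2) + 0 = y' →
      (c0 B (c0 B (strictM g 0 1 c' a') : B.M x' y') : B.M x y) = c0 B (g i j b) := by
    intro c' a' i j b hi hj hb x' y' hx hy
    rw [c0_c0 (by simpa using hx) (by simpa using hy), strictM_zero_one,
      c0_c0 (by simp) (by simp), hb, GMap.c0_apply _ hi hj]
  have reindex : ∀ σ τ : Fin kIn → Fin (0 + kIn + 0), σ = τ →
      (c0 B (g _ _ (N (fun l => c (σ l)) fun l => a (σ l))) : B.M x y)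
        = c0 B (g _ _ (N (fun l => c (τ l)) fun l => a (τ l))) := by
    rintro σ _ rfl; rfl
  simp only [insEval, Finset.univ_eq_empty, Finset.sum_empty, mul_zero, add_zero,
    Int.negOnePow_zero, Units.val_one, one_smul]
  rw [key _ _ _ _ (N _ fun l' => a ⟨0 + l', by omega⟩) rfl rfl rfl]
  · exact reindex (fun l => ⟨0 + l, by omega⟩) _ (by funext l; ext; simp)
  all_goals
    simp only [Fin.sum_univ_one, add_zero, zero_add, Nat.cast_zero, neg_zero]
    simp
    exact Fintype.sum_equiv (finCongr (by simp)) _ _ fun _ => rfl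

theorem insEval_strictM_of_not (g : GMap A B 0 0) {r i kIn t : ℕ} {pN qN : ℤ}
    (N : GMulti A A kIn pN qN) (h : ¬ (i = 0 ∧ r + 1 + t = 1))
    (c : Fin (r + kIn + t) → ℤ × ℤ) (a : ∀ l, A.M (c l).1 (c l).2) :
    insEval r t (strictM g i (r + 1 + t)) N c a = 0 := by
  simp [insEval, strictM_of_not g h]

theorem blockEval_strictM_of_not {pM qM : ℤ} {j v : ℕ} (g : GMap A B 0 0) (ps qs : Fin j → ℕ)
    (Mo : GMulti B C j pM qM) (h : ¬ ∀ s, ps s = 0 ∧ qs s = 1)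
    (c : Fin v → ℤ × ℤ) (a : ∀ l, A.M (c l).1 (c l).2) :
    blockEval j v qs Mo (fun s => (-(ps s : ℤ), 1 - (ps s : ℤ) - (qs s : ℤ)))
      (fun s => strictM g (ps s) (qs s)) c a = 0 := by
  push Not at h
  obtain ⟨s, hs⟩ := h
  simp only [blockEval]
  rw [(Mo _).map_coord_zero s, map_zero, smul_zero]
  rw [strictM_of_not g (by tauto)]
  rfl

theorem blockEval_strictM {pM qM : ℤ} {v : ℕ} (g : GMap A B 0 0)
    (Mo : GMulti B C v pM qM)
    (c : Fin v → ℤ × ℤ) (a : ∀ l, A.M (c l).1 (c l).2) {x y : ℤ} :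
    (c0 C (blockEval v v (fun _ => 1) Mo
      (fun _ => (-((0 : ℕ) : ℤ), 1 - ((0 : ℕ) : ℤ) - ((1 : ℕ) : ℤ)))
      (fun _ => strictM g 0 1) c a) : C.M x y)
      = c0 C (Mo c fun l => g.flat _ _ (a l)) := by
  have hoff : ∀ s : Fin v, (∑ s' : Fin v, if (s' : ℕ) < (s : ℕ) then 1 else 0) = (s : ℕ) := by
    intro s
    rw [Finset.sum_boole]
    simp only [← Fin.lt_def, Finset.filter_gt_eq_Iio, Fin.card_Iio, Nat.cast_id]
  have hcol : ∀ (n : ℕ) (s : Fin v) (cPad : ℕ → ℤ × ℤ), n = s → c s = cPad s →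
      c s = ((∑ l : Fin 1, (cPad (n + l)).1) + (-((0 : ℕ) : ℤ)),
        (∑ l : Fin 1, (cPad (n + l)).2) + (1 - ((0 : ℕ) : ℤ) - ((1 : ℕ) : ℤ))) := by
    rintro _ s cPad rfl h
    simp [h]
  have hval : ∀ (n : ℕ) (s : Fin v) (cPad : ℕ → ℤ × ℤ) (aPad : ∀ n, A.M (cPad n).1 (cPad n).2),
      n = s → c s = cPad s → aPad s = c0 A (a s) → ∀ {x y : ℤ},
      (c0 B (strictM g 0 1 (fun l => cPad (n + l)) fun l => aPad (n + l)) : B.M x y)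
        = c0 B (g.flat _ _ (a s)) := by
    rintro _ s cPad aPad rfl hc ha x y
    have h := strictM_zero_one g (fun l : Fin 1 => cPad (s + l)) fun l => aPad (s + l)
    rw [h, c0_c0 (by simp) (by simp), GMap.c0_flat]
    change c0 B (g _ _ (aPad s)) = _
    rw [ha, GMap.c0_apply] <;> rw [hc]
  have key : ∀ (c' : Fin v → ℤ × ℤ) (b : ∀ l, B.M (c' l).1 (c' l).2), (∀ l, c l = c' l) →
      (∀ l, b l = c0 B (g.flat _ _ (a l))) → ∀ {x' y' : ℤ},
      (∑ l, (c l).1) + pM = x' → (∑ l, (c l).2) + qM = y' →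
      (c0 C (c0 C (Mo c' b) : C.M x' y') : C.M x y) = c0 C (Mo c fun l => g.flat _ _ (a l)) := by
    intro c' b hc hb x' y' hx hy
    obtain rfl := funext hc
    rw [c0_c0 hx hy, funext hb]
    simp
  have hsgn : ∀ (P Q : Fin v → ℤ), (Int.negOnePow (∑ s' : Fin v, ∑ s : Fin v,
      if (s : ℕ) < (s' : ℕ) then
        (-((0 : ℕ) : ℤ)) * P s + (1 - ((0 : ℕ) : ℤ) - ((1 : ℕ) : ℤ)) * Q s else 0) : ℤ) = 1 := by
    simp
  refine (map_zsmul (c0 C) _ _).trans ((congrArg₂ (· • ·) (hsgn _ _) ?_).trans (one_smul ℤ _))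
  refine key _ _ (fun l => ?_) (fun l => ?_) ?_ ?_
  · exact hcol _ l (fun n => if h : n < v then c ⟨n, h⟩ else 0) (hoff l) (by simp)
  · rw [← c0_self (strictM g 0 1 _ _)]
    exact hval _ l (fun n => if h : n < v then c ⟨n, h⟩ else 0)
      (fun n => if h : n < v then c0 A (a ⟨n, h⟩) else 0) (hoff l) (by simp) (by simp)
  · simp
  · simp

theorem sum_insEval_strictM (g : GMap A B 0 0)
    (m : ∀ i k : ℕ, GMulti A A k (-(i : ℤ)) (2 - i - k)) (u v : ℕ) (hv : 1 ≤ v)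
    (c : Fin v → ℤ × ℤ) (a : ∀ l, A.M (c l).1 (c l).2) {x y : ℤ} :
    (∑ z ∈ (dAIdx u v).attach,
      ((-1 : ℤ) ^ (z.1.2.1 * z.1.2.2 + (v - z.1.2.2 - z.1.2.1)
          + (u - z.1.1) * (z.1.2.1 + 1 + (v - z.1.2.2 - z.1.2.1)))) •
        (c0 B (insEval z.1.2.1 (v - z.1.2.2 - z.1.2.1)
          (strictM g z.1.1 (z.1.2.1 + 1 + (v - z.1.2.2 - z.1.2.1)))
          (m (u - z.1.1) z.1.2.2)
          (fun l => c (Fin.cast (by have := dAIdx_spec z.2; omega) l))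
          (fun l => a (Fin.cast (by have := dAIdx_spec z.2; omega) l))) : B.M x y))
      = (-1 : ℤ) ^ u • c0 B (g.flat _ _ (m u v c a)) := by
  have hmem : ((0, 0, v) : ℕ × ℕ × ℕ) ∈ dAIdx u v := by
    simp [dAIdx]; omega
  rw [Finset.sum_eq_single ⟨(0, 0, v), hmem⟩]
  · have ht : v - v - 0 = 0 := by omega
    have hs : 0 * v + (v - v - 0) + (u - 0) * (0 + 1 + (v - v - 0)) = u := by simp
    rw [hs]
    congr 1
    refine (insEval_strictM g (m u v) ht _ _).trans ?_
    rw [GMap.c0_flat]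
    rfl
  · rintro ⟨⟨i, s, q⟩, hz⟩ - hne
    have hz' : i ≤ u ∧ 1 ≤ q ∧ s + q ≤ v := dAIdx_spec hz
    dsimp only
    rw [insEval_strictM_of_not, map_zero, smul_zero]
    rintro ⟨rfl, h⟩
    obtain rfl : s = 0 := by omega
    obtain rfl : q = v := by omega
    exact hne rfl
  · simp

theorem sum_blockEval_strictM {e : ℤ} (g : GMap A B 0 0)
    (M : ∀ i k : ℕ, GMulti B C k (-(i : ℤ)) (e - i - k)) (w u v : ℕ) (hv : 1 ≤ v)
    (c : Fin v → ℤ × ℤ) (a : ∀ l, A.M (c l).1 (c l).2) {x y : ℤ} :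
    (∑ i ∈ Finset.range (u + 1), ∑ j ∈ Finset.Icc 1 v,
        ∑ qs ∈ (Finset.Nat.antidiagonalTuple j v).filter (fun qs => ∀ s, 1 ≤ qs s),
          ∑ ps ∈ Finset.Nat.antidiagonalTuple j (u - i),
            ((-1 : ℤ) ^ (w + ∑ s : Fin j, ((ps s + qs s) * (j + (s : ℕ) + 1)
                + qs s * (∑ w : Fin j, if (s : ℕ) < (w : ℕ) then ps w + qs w else 0)))) •
              (c0 C (blockEval j v qs (M i j)
                (fun s => (-(ps s : ℤ), 1 - (ps s : ℤ) - (qs s : ℤ)))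
                (fun s => strictM g (ps s) (qs s)) c a) : C.M x y))
      = (-1 : ℤ) ^ w • c0 C (M u v c fun l => g.flat _ _ (a l)) := by
  have hone : ∀ {i j : ℕ} {ps qs : Fin j → ℕ}, i ≤ u →
      qs ∈ (Finset.Nat.antidiagonalTuple j v).filter (fun qs => ∀ s, 1 ≤ qs s) →
      ps ∈ Finset.Nat.antidiagonalTuple j (u - i) →
      ¬(i = u ∧ j = v ∧ (∀ s, qs s = 1) ∧ ∀ s, ps s = 0) → ¬ ∀ s, ps s = 0 ∧ qs s = 1 := by
    intro i j ps qs hi hq hp hn h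
    rw [Finset.mem_filter, Finset.Nat.mem_antidiagonalTuple] at hq
    rw [Finset.Nat.mem_antidiagonalTuple] at hp
    refine hn ⟨?_, ?_, fun s => (h s).2, fun s => (h s).1⟩
    · simp only [fun s => (h s).1, Finset.sum_const_zero] at hp
      omega
    · simpa [fun s => (h s).2] using hq.1
  rw [Finset.sum_eq_single u, Finset.sum_eq_single v, Finset.sum_eq_single fun _ => 1,
    Finset.sum_eq_single fun _ => 0]
  · have hs : Even (∑ s : Fin v, ((0 + 1) * (v + (s : ℕ) + 1)
        + 1 * (∑ w : Fin v, if (s : ℕ) < (w : ℕ) then 0 + 1 else 0))) := by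
      refine Finset.even_sum _ fun s _ => ?_
      have : (∑ w : Fin v, if (s : ℕ) < (w : ℕ) then 0 + 1 else 0) = v - 1 - s := by
        rw [zero_add, Finset.sum_boole]
        simp only [← Fin.lt_def, Finset.filter_lt_eq_Ioi, Fin.card_Ioi, Nat.cast_id]
      rw [this]
      exact ⟨v, by omega⟩
    rw [pow_add, hs.neg_one_pow, mul_one]
    congr 1
    exact blockEval_strictM g (M u v) c a
  · intro ps hp hne
    rw [blockEval_strictM_of_not, map_zero, smul_zero]
    exact fun h => hne (funext fun s => (h s).1)
  · exact fun h => absurd (by simp [Finset.Nat.mem_antidiagonalTuple]) h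
  · intro qs hq hne
    refine Finset.sum_eq_zero fun ps hp => ?_
    rw [blockEval_strictM_of_not, map_zero, smul_zero]
    exact fun h => hne (funext fun s => (h s).2)
  · exact fun h => absurd (by simp [Finset.Nat.mem_antidiagonalTuple]) h
  · intro j hj hne
    refine Finset.sum_eq_zero fun qs hq => Finset.sum_eq_zero fun ps hp => ?_
    rw [blockEval_strictM_of_not _ _ _ _ (hone le_rfl hq hp (by tauto)), map_zero, smul_zero]
  · simp [hv]
  · intro i hi hne
    refine Finset.sum_eq_zero fun j hj => Finset.sum_eq_zero fun qs hq =>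
      Finset.sum_eq_zero fun ps hp => ?_
    rw [blockEval_strictM_of_not _ _ _ _
      (hone (Nat.lt_succ_iff.mp (Finset.mem_range.mp hi)) hq hp (by tauto)), map_zero, smul_zero]
  · simp

theorem isdAMor_strictM {mA : ∀ i k : ℕ, GMulti A A k (-(i : ℤ)) (2 - i - k)}
    {mB : ∀ i k : ℕ, GMulti B B k (-(i : ℤ)) (2 - i - k)} (g : GMap A B 0 0)
    (h : ∀ i k : ℕ, 1 ≤ k → ∀ (c : Fin k → ℤ × ℤ) (a : ∀ l, A.M (c l).1 (c l).2),
      g.flat _ _ (mA i k c a) = mB i k c fun l => g.flat _ _ (a l)) :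
    IsdAMor mA mB (strictM g) := by
  intro u v hv c a
  refine (sum_insEval_strictM g mA u v hv c a).trans ?_
  rw [h u v hv]
  exact (sum_blockEval_strictM g mB u u v hv c a).symm

theorem isdAComp_strictM {f : GMap B C 0 0} {g : GMap A B 0 0} {h : GMap A C 0 0}
    (H : ∀ i j (a : A.M i j), h.flat i j a = f.flat i j (g.flat i j a)) :
    IsdAComp (strictM g) (strictM f) (strictM h) := by
  intro u k hk c a
  have key := sum_blockEval_strictM (e := 1) g (strictM f) 0 u k hk c a
    (x := (∑ l, (c l).1) + (-(u : ℤ))) (y := (∑ l, (c l).2) + (1 - u - k))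
  simp only [zero_add, pow_zero, one_smul] at key
  refine Eq.trans ?_ key.symm
  rw [c0_self]
  by_cases huk : u = 0 ∧ k = 1
  · obtain ⟨rfl, rfl⟩ := huk
    rw [strictM_zero_one, strictM_zero_one, ← GMap.c0_flat, ← GMap.c0_flat, H]
  · rw [strictM_of_not _ huk, strictM_of_not _ huk]
    rfl

end Strict

section Path

variable {r : ℕ} {A : Bigraded R}

theorem path_ext {i j : ℤ} {w w' : (pathBG r A).M i j} (h1 : pp1 r A i j w = pp1 r A i j w')
    (h2 : pp2 r A i j w = pp2 r A i j w') (h3 : pp3 r A i j w = pp3 r A i j w') : w = w' :=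
  Prod.ext h1 (Prod.ext h2 h3)

theorem pp1_c0 {i j i' j' : ℤ} (hi : i = i') (hj : j = j') (w : (pathBG r A).M i j) :
    pp1 r A i' j' (c0 (pathBG r A) w) = c0 A (pp1 r A i j w) := by
  subst hi hj
  simp

theorem pp2_c0 {i j i' j' : ℤ} (hi : i = i') (hj : j = j') (w : (pathBG r A).M i j) :
    pp2 r A i' j' (c0 (pathBG r A) w) = c0 A (pp2 r A i j w) := by
  subst hi hj
  simp

theorem pp3_c0 {i j i' j' : ℤ} (hi : i = i') (hj : j = j') (w : (pathBG r A).M i j) :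
    pp3 r A i' j' (c0 (pathBG r A) w) = c0 A (pp3 r A i j w) := by
  subst hi hj
  simp

theorem projMinusG_flat (i j : ℤ) (w : (pathBG r A).M i j) :
    (projMinusG r A).flat i j w = pp1 r A i j w := by
  simp [GMap.flat, projMinusG, cast_eq_c0, c0_c0]

theorem projPlusG_flat (i j : ℤ) (w : (pathBG r A).M i j) :
    (projPlusG r A).flat i j w = pp3 r A i j w := by
  simp [GMap.flat, projPlusG, cast_eq_c0, c0_c0]

theorem idG_flat (i j : ℤ) (x : A.M i j) : (idG A).flat i j x = x := by
  simp [GMap.flat, idG, cast_eq_c0, c0_c0]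

theorem pp1_iotaG_flat (i j : ℤ) (x : A.M i j) :
    pp1 r A i j ((iotaG r A).flat i j x) = x := by
  simp only [GMap.flat, LinearMap.comp_apply]
  rw [pp1_c0 (by simp) (by simp)]
  simp only [iotaG, cast_eq_c0]
  change c0 A (c0 A x) = x
  rw [c0_c0 (by simp) (by simp), c0_self]

theorem pp2_iotaG_flat (i j : ℤ) (x : A.M i j) :
    pp2 r A i j ((iotaG r A).flat i j x) = 0 := by
  simp only [GMap.flat, LinearMap.comp_apply]
  rw [pp2_c0 (by simp) (by simp)]
  exact map_zero _

theorem pp3_iotaG_flat (i j : ℤ) (x : A.M i j) :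
    pp3 r A i j ((iotaG r A).flat i j x) = x := by
  simp only [GMap.flat, LinearMap.comp_apply]
  rw [pp3_c0 (by simp) (by simp)]
  simp only [iotaG, cast_eq_c0]
  change c0 A (c0 A x) = x
  rw [c0_c0 (by simp) (by simp), c0_self]

theorem pp1_DeltaMap_flat (i j : ℤ) (w : (pathBG r A).M i j) :
    pp1 r (pathBG r A) i j (GMap.flat (DeltaMap r A) i j w)
      = (iotaG r A).flat i j (pp1 r A i j w) := by
  have h : pp1 r (pathBG r A) _ _ (DeltaMap r A i j w) = iotaG r A i j (pp1 r A i j w) := by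
    simp only [iotaG, cast_eq_c0]
    rfl
  simp only [GMap.flat, LinearMap.comp_apply]
  rw [pp1_c0 (by simp) (by simp), h]

theorem pp3_DeltaMap_flat (i j : ℤ) (w : (pathBG r A).M i j) :
    pp3 r (pathBG r A) i j (GMap.flat (DeltaMap r A) i j w) = w := by
  have h : pp3 r (pathBG r A) _ _ (DeltaMap r A i j w) = c0 (pathBG r A) w := by
    apply path_ext
    · rw [pp1_c0 (by simp) (by simp)]; rfl
    · rw [pp2_c0 (by simp) (by simp)]; rfl
    · rw [pp3_c0 (by simp) (by simp)]; rfl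
  simp only [GMap.flat, LinearMap.comp_apply]
  rw [pp3_c0 (by simp) (by simp), h, c0_c0 (by simp) (by simp), c0_self]

/-- The inclusion `y ↦ (0, 0, y)` of `A` in its path as the end point `e₊ ⊗ A`. -/
def pathEnd (r : ℕ) (A : Bigraded R) (i j : ℤ) : A.M i j →ₗ[R] (pathBG r A).M i j :=
  LinearMap.prod 0 (LinearMap.prod 0 LinearMap.id)

theorem pp1_pathEnd (i j : ℤ) (y : A.M i j) : pp1 r A i j (pathEnd r A i j y) = 0 := rfl

theorem pp2_pathEnd (i j : ℤ) (y : A.M i j) : pp2 r A i j (pathEnd r A i j y) = 0 := rfl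

theorem pp3_pathEnd (i j : ℤ) (y : A.M i j) : pp3 r A i j (pathEnd r A i j y) = y := rfl

theorem pp2_DeltaMap_flat (i j : ℤ) (w : (pathBG r A).M i j) :
    pp2 r (pathBG r A) i j (GMap.flat (DeltaMap r A) i j w)
      = pathEnd r A _ _ (pp2 r A i j w) := by
  have h : pp2 r (pathBG r A) _ _ (DeltaMap r A i j w)
      = c0 (pathBG r A) (pathEnd r A _ _ (pp2 r A i j w)) := by
    apply path_ext
    · rw [pp1_c0 (by simp) (by simp), pp1_pathEnd, map_zero]; rfl
    · rw [pp2_c0 (by simp) (by simp), pp2_pathEnd, map_zero]; rfl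
    · rw [pp3_c0 (by simp) (by simp), pp3_pathEnd]; rfl
  simp only [GMap.flat, LinearMap.comp_apply]
  rw [pp2_c0 (by simp) (by simp), h, c0_c0 (by simp) (by simp), c0_self]

theorem iota_projMinus_flat (i j : ℤ) (w : (pathBG r A).M i j) :
    GMap.flat (grecast 0 0 (by ring) (by ring) (gcomp (iotaG r A) (projMinusG r A))) i j w
      = (iotaG r A).flat i j (pp1 r A i j w) := by
  simp only [GMap.flat, grecast, gcomp, LinearMap.comp_apply, cast_eq_c0]
  rw [c0_c0 (by simp) (by simp), c0_c0 (by simp) (by simp)]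
  simp only [projMinusG, LinearMap.comp_apply, cast_eq_c0]
  exact GMap.c0_apply (iotaG r A) (by simp) (by simp) _

variable {m : ∀ i k : ℕ, GMulti A A k (-(i : ℤ)) (2 - i - k)}

theorem pathOps_one (i : ℕ) (c : Fin 1 → ℤ × ℤ) (a : ∀ l, (pathBG r A).M (c l).1 (c l).2) :
    pathOps r m i 1 c a = c0 (pathBG r A) (pathD1 r m i (c 0).1 (c 0).2 (a 0)) :=
  toGM1_apply (pathD1 r m i) c a

theorem pathOps_of_two_le (i : ℕ) {k : ℕ} (hk : 2 ≤ k) (c : Fin k → ℤ × ℤ) :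
    pathOps r m i k c = pathDHigher r m i k c := by
  simp only [pathOps, show k ≠ 1 by omega, hk, dite_true, dite_false]

theorem c0_fromGM1 {p q : ℤ} (M : GMulti A A 1 p q) (c : Fin 1 → ℤ × ℤ)
    (a : ∀ l, A.M (c l).1 (c l).2) {x y : ℤ} :
    (c0 A (fromGM1 M (c 0).1 (c 0).2 (a 0)) : A.M x y) = c0 A (M c a) := by
  obtain ⟨z, rfl⟩ : ∃ z, c = fun _ => z := ⟨c 0, by ext l <;> simp [Subsingleton.elim l 0]⟩
  rw [fromGM1_apply, c0_c0 (by simp) (by simp)]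
  congr
  funext l
  rw [Subsingleton.elim l 0]

theorem pp1_pathOps (i : ℕ) {k : ℕ} (hk : 1 ≤ k) (c : Fin k → ℤ × ℤ)
    (a : ∀ l, (pathBG r A).M (c l).1 (c l).2) :
    pp1 r A _ _ (pathOps r m i k c a) = m i k c fun l => pp1 r A _ _ (a l) := by
  obtain rfl | hk := hk.eq_or_lt
  · rw [pathOps_one, pp1_c0 (by simp) (by simp)]
    change c0 A (c0 A (fromGM1 (m i 1) _ _ (pp1 r A _ _ (a 0)))) = _
    rw [c0_c0 (by simp) (by simp), c0_fromGM1 (m i 1) c fun l => pp1 r A _ _ (a l), c0_self]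
  · rw [pathOps_of_two_le i hk]
    rfl

theorem pp3_pathOps (i : ℕ) {k : ℕ} (hk : 1 ≤ k) (c : Fin k → ℤ × ℤ)
    (a : ∀ l, (pathBG r A).M (c l).1 (c l).2) :
    pp3 r A _ _ (pathOps r m i k c a) = m i k c fun l => pp3 r A _ _ (a l) := by
  obtain rfl | hk := hk.eq_or_lt
  · rw [pathOps_one, pp3_c0 (by simp) (by simp)]
    change c0 A (c0 A (fromGM1 (m i 1) _ _ (pp3 r A _ _ (a 0)))) = _
    rw [c0_c0 (by simp) (by simp), c0_fromGM1 (m i 1) c fun l => pp3 r A _ _ (a l), c0_self]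
  · rw [pathOps_of_two_le i hk]
    rfl

/-- The colouring of the middle summand of the path. -/
def pathMid (r : ℕ) {k : ℕ} (c : Fin k → ℤ × ℤ) : Fin k → ℤ × ℤ :=
  fun l => ((c l).1 + r, (c l).2 + r - 1)

/-- The projection of the path to its middle summand, indexed along a colouring. -/
def ppMid (r : ℕ) (A : Bigraded R) {k : ℕ} (c : Fin k → ℤ × ℤ) (l : Fin k) :
    (pathBG r A).M (c l).1 (c l).2 →ₗ[R] A.M (pathMid r c l).1 (pathMid r c l).2 :=
  pp2 r A (c l).1 (c l).2

theorem ppMid_iotaG_flat {k : ℕ} (c : Fin k → ℤ × ℤ) (l : Fin k) (x : A.M (c l).1 (c l).2) :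
    ppMid r A c l ((iotaG r A).flat _ _ x) = 0 :=
  pp2_iotaG_flat _ _ x

theorem ppMid_pathEnd {k : ℕ} (c : Fin k → ℤ × ℤ) (l : Fin k) (y : A.M (c l).1 (c l).2) :
    ppMid r A c l (pathEnd r A _ _ y) = 0 := rfl

theorem ppMid_DeltaMap_flat {k : ℕ} (c : Fin k → ℤ × ℤ) (l : Fin k)
    (w : (pathBG r A).M (c l).1 (c l).2) :
    ppMid r (pathBG r A) c l (GMap.flat (DeltaMap r A) _ _ w)
      = pathEnd r A _ _ (ppMid r A c l w) :=
  pp2_DeltaMap_flat _ _ w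

theorem pp2_pathOps_one_self (c : Fin 1 → ℤ × ℤ)
    (a : ∀ l, (pathBG r A).M (c l).1 (c l).2) :
    pp2 r A _ _ (pathOps r m r 1 c a)
      = - c0 A (pp1 r A _ _ (a 0))
        - c0 A (m r 1 (pathMid r c) fun l => ppMid r A c l (a l))
        + c0 A (pp3 r A _ _ (a 0)) := by
  have h : pp2 r A _ _ (pathD1 r m r (c 0).1 (c 0).2 (a 0))
      = - c0 A (pp1 r A _ _ (a 0))
        - c0 A (fromGM1 (m r 1) _ _ (pp2 r A _ _ (a 0)))
        + c0 A (pp3 r A _ _ (a 0)) := by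
    simp only [pathD1, dite_true]
    rfl
  rw [pathOps_one, pp2_c0 (by simp) (by simp), h, map_add, map_sub, map_neg,
    c0_c0 (by ring) (by ring), c0_c0 (by ring) (by ring), c0_c0 (by ring) (by ring)]
  congr 2
  exact c0_fromGM1 (m r 1) (pathMid r c) fun l => ppMid r A c l (a l)

theorem pp2_pathOps_one_of_ne {i : ℕ} (hi : i ≠ r) (c : Fin 1 → ℤ × ℤ)
    (a : ∀ l, (pathBG r A).M (c l).1 (c l).2) :
    pp2 r A _ _ (pathOps r m i 1 c a)
      = (-1 : ℤ) ^ (i + r + 1) •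
        c0 A (m i 1 (pathMid r c) fun l => ppMid r A c l (a l)) := by
  have h : pp2 r A _ _ (pathD1 r m i (c 0).1 (c 0).2 (a 0))
      = (-1 : ℤ) ^ (i + r + 1) • c0 A (fromGM1 (m i 1) _ _ (pp2 r A _ _ (a 0))) := by
    simp only [pathD1, hi, dite_false]
    rfl
  rw [pathOps_one, pp2_c0 (by simp) (by simp), h, map_zsmul, c0_c0 (by ring) (by ring)]
  congr 1
  exact c0_fromGM1 (m i 1) (pathMid r c) fun l => ppMid r A c l (a l)

/-- The colouring `c` with its entry at `kk` replaced by that of the middle summand of the path. -/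
def pathShift (r : ℕ) {k : ℕ} (c : Fin k → ℤ × ℤ) (kk : Fin k) : Fin k → ℤ × ℤ :=
  fun l => if l = kk then ((c l).1 + r, (c l).2 + r - 1) else c l

/-- The `l`-th component of the `kk`-th summand of the map `t_k` in the definition of the higher
operations of the path: the end point `x` (with its sign) to the left of `kk`, the middle
component `y` at `kk`, and the end point `z` to the right of `kk`. -/
def pathMix (r : ℕ) (A : Bigraded R) {k : ℕ} (c : Fin k → ℤ × ℤ) (kk l : Fin k) :
    (pathBG r A).M (c l).1 (c l).2 →ₗ[R] A.M (pathShift r c kk l).1 (pathShift r c kk l).2 :=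
  if l = kk then (c0 A).comp (pp2 r A (c l).1 (c l).2)
  else if (l : ℕ) < (kk : ℕ) then
    (c0 A).comp
      ((Int.negOnePow ((r : ℤ) * (c l).1 + (1 - (r : ℤ)) * (c l).2) : ℤ) • pp1 r A (c l).1 (c l).2)
  else (c0 A).comp (pp3 r A (c l).1 (c l).2)

theorem pathShift_self {k : ℕ} (c : Fin k → ℤ × ℤ) (kk : Fin k) :
    pathShift r c kk kk = ((c kk).1 + r, (c kk).2 + r - 1) := by
  simp [pathShift]

theorem pathShift_of_ne {k : ℕ} (c : Fin k → ℤ × ℤ) {kk l : Fin k} (h : l ≠ kk) :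
    pathShift r c kk l = c l := by
  simp [pathShift, h]

theorem sum_pathShift_fst {k : ℕ} (c : Fin k → ℤ × ℤ) (kk : Fin k) :
    ∑ l, (pathShift r c kk l).1 = ∑ l, (c l).1 + r := by
  have h : ∀ l, (pathShift r c kk l).1 = (c l).1 + if l = kk then (r : ℤ) else 0 := by
    intro l
    unfold pathShift
    split_ifs <;> simp
  simp [h, Finset.sum_add_distrib]

theorem sum_pathShift_snd {k : ℕ} (c : Fin k → ℤ × ℤ) (kk : Fin k) :
    ∑ l, (pathShift r c kk l).2 = ∑ l, (c l).2 + (r - 1) := by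
  have h : ∀ l, (pathShift r c kk l).2 = (c l).2 + if l = kk then (r : ℤ) - 1 else 0 := by
    intro l
    unfold pathShift
    split_ifs
    · simp only; ring
    · simp
  simp [h, Finset.sum_add_distrib]

theorem pathMix_self {k : ℕ} (c : Fin k → ℤ × ℤ) (kk : Fin k)
    (w : (pathBG r A).M (c kk).1 (c kk).2) :
    pathMix r A c kk kk w = c0 A (pp2 r A _ _ w) := by
  simp [pathMix]

theorem pathMix_of_lt {k : ℕ} (c : Fin k → ℤ × ℤ) {kk l : Fin k} (h : l < kk)
    (w : (pathBG r A).M (c l).1 (c l).2) :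
    pathMix r A c kk l w
      = (Int.negOnePow ((r : ℤ) * (c l).1 + (1 - (r : ℤ)) * (c l).2) : ℤ)
          • c0 A (pp1 r A _ _ w) := by
  have h' : (l : ℕ) < kk := h
  simp only [pathMix, h.ne, h', if_true, if_false, LinearMap.comp_apply, LinearMap.smul_apply]
  exact map_zsmul _ _ _

theorem pathMix_of_gt {k : ℕ} (c : Fin k → ℤ × ℤ) {kk l : Fin k} (h : kk < l)
    (w : (pathBG r A).M (c l).1 (c l).2) :
    pathMix r A c kk l w = c0 A (pp3 r A _ _ w) := by
  have h' : ¬ (l : ℕ) < kk := not_lt.mpr h.le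
  simp [pathMix, h.ne', h']

theorem pathMix_DeltaMap_self {k : ℕ} (c : Fin k → ℤ × ℤ) (kk : Fin k)
    (w : (pathBG r A).M (c kk).1 (c kk).2) :
    pathMix r (pathBG r A) c kk kk (GMap.flat (DeltaMap r A) _ _ w)
      = c0 (pathBG r A) (pathEnd r A _ _ (pp2 r A _ _ w)) := by
  rw [pathMix_self, pp2_DeltaMap_flat]

theorem pathMix_DeltaMap_of_lt {k : ℕ} (c : Fin k → ℤ × ℤ) {kk l : Fin k} (h : l < kk)
    (w : (pathBG r A).M (c l).1 (c l).2) :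
    pathMix r (pathBG r A) c kk l (GMap.flat (DeltaMap r A) _ _ w)
      = (Int.negOnePow ((r : ℤ) * (c l).1 + (1 - (r : ℤ)) * (c l).2) : ℤ)
          • c0 (pathBG r A) ((iotaG r A).flat _ _ (pp1 r A _ _ w)) := by
  rw [pathMix_of_lt c h, pp1_DeltaMap_flat]

theorem pp3_pathMix_DeltaMap {k : ℕ} (c : Fin k → ℤ × ℤ) (kk l : Fin k)
    (w : (pathBG r A).M (c l).1 (c l).2) :
    pp3 r A _ _ (pathMix r (pathBG r A) c kk l (GMap.flat (DeltaMap r A) _ _ w))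
      = pathMix r A c kk l w := by
  obtain h | rfl | h := lt_trichotomy l kk
  · rw [pathMix_DeltaMap_of_lt c h, map_zsmul,
      pp3_c0 (by simp [pathShift_of_ne c h.ne]) (by simp [pathShift_of_ne c h.ne]),
      pp3_iotaG_flat, pathMix_of_lt c h]
  · rw [pathMix_DeltaMap_self, pp3_c0 (by simp [pathShift_self]) (by simp [pathShift_self]),
      pp3_pathEnd, pathMix_self]
  · rw [pathMix_of_gt c h, pathMix_of_gt c h, pp3_DeltaMap_flat,
      pp3_c0 (by simp [pathShift_of_ne c h.ne']) (by simp [pathShift_of_ne c h.ne'])]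

theorem pp2_pathOps_of_two_le (i : ℕ) {k : ℕ} (hk : 2 ≤ k) (c : Fin k → ℤ × ℤ)
    (a : ∀ l, (pathBG r A).M (c l).1 (c l).2) :
    pp2 r A _ _ (pathOps r m i k c a)
      = (-1 : ℤ) ^ (r * k + i + k) • ∑ kk : Fin k,
          c0 A (m i k (pathShift r c kk) fun l => pathMix r A c kk l (a l)) := by
  rw [pathOps_of_two_le i hk]
  have h : pp2 r A _ _ (pathDHigher r m i k c a)
      = ((-1 : ℤ) ^ (r * k + i + k) • ∑ kk : Fin k, (c0 A).compMultilinearMap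
          ((m i k (pathShift r c kk)).compLinearMap (pathMix r A c kk)) :
        MultilinearMap R (fun l => (pathBG r A).M (c l).1 (c l).2) (A.M _ _)) a := rfl
  rw [h]
  simp

theorem projMinusG_isdAMor : IsdAMor (pathOps r m) m (strictM (projMinusG r A)) := by
  refine isdAMor_strictM _ fun i k hk c a => ?_
  rw [projMinusG_flat, pp1_pathOps i hk]
  simp only [projMinusG_flat]

theorem iotaG_comm (i : ℕ) {k : ℕ} (hk : 1 ≤ k) (c : Fin k → ℤ × ℤ)
    (a : ∀ l, A.M (c l).1 (c l).2) :
    (iotaG r A).flat _ _ (m i k c a)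
      = pathOps r m i k c fun l => (iotaG r A).flat _ _ (a l) := by
  apply path_ext
  · rw [pp1_iotaG_flat, pp1_pathOps i hk]
    simp only [pp1_iotaG_flat]
  · rw [pp2_iotaG_flat]
    symm
    obtain rfl | hk := hk.eq_or_lt
    · obtain rfl | hi := eq_or_ne i r
      · rw [pp2_pathOps_one_self, (m i 1 _).map_coord_zero 0 (ppMid_iotaG_flat _ _ _), pp1_iotaG_flat,
          pp3_iotaG_flat, map_zero]
        abel
      · rw [pp2_pathOps_one_of_ne hi, (m i 1 _).map_coord_zero 0 (ppMid_iotaG_flat _ _ _), map_zero,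
          smul_zero]
    · rw [pp2_pathOps_of_two_le i hk]
      refine (congrArg _ (Finset.sum_eq_zero fun kk _ => ?_)).trans (smul_zero _)
      rw [(m i k _).map_coord_zero kk, map_zero]
      rw [pathMix_self, pp2_iotaG_flat, map_zero]
  · rw [pp3_iotaG_flat, pp3_pathOps i hk]
    simp only [pp3_iotaG_flat]

theorem DeltaMap_comm (i : ℕ) {k : ℕ} (hk : 1 ≤ k) (c : Fin k → ℤ × ℤ)
    (a : ∀ l, (pathBG r A).M (c l).1 (c l).2) :
    GMap.flat (DeltaMap r A) _ _ (pathOps r m i k c a)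
      = pathOps r (pathOps r m) i k c fun l => GMap.flat (DeltaMap r A) _ _ (a l) := by
  apply path_ext
  · rw [pp1_DeltaMap_flat, pp1_pathOps i hk, pp1_pathOps i hk, iotaG_comm i hk]
    simp only [pp1_DeltaMap_flat]
  · rw [pp2_DeltaMap_flat]
    obtain rfl | hk := hk.eq_or_lt
    · obtain rfl | hi := eq_or_ne i r
      · rw [pp2_pathOps_one_self (m := pathOps i m), pp1_DeltaMap_flat, pp3_DeltaMap_flat]
        simp only [ppMid_DeltaMap_flat]
        apply path_ext
        · rw [map_add, map_sub, map_neg, pp1_c0 (by simp) (by simp; ring),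
            pp1_c0 (by simp [pathMid]) (by simp [pathMid]; ring),
            pp1_c0 (by simp) (by simp; ring), pp1_iotaG_flat, pp1_pathEnd, pp1_pathOps i le_rfl,
            (m i 1 _).map_coord_zero 0 (pp1_pathEnd _ _ _), map_zero]
          abel
        · rw [map_add, map_sub, map_neg, pp2_c0 (by simp) (by simp; ring),
            pp2_c0 (by simp [pathMid]) (by simp [pathMid]; ring),
            pp2_c0 (by simp) (by simp; ring), pp2_iotaG_flat, pp2_pathEnd, pp2_pathOps_one_self,
            (m i 1 _).map_coord_zero 0 (ppMid_pathEnd _ _ _), pp1_pathEnd, pp3_pathEnd]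
          simp only [map_zero, neg_zero, sub_zero, zero_add, zero_sub]
          rw [c0_c0 (by simp [pathMid]) (by simp [pathMid]; ring)]
          exact (neg_add_cancel _).symm
        · rw [map_add, map_sub, map_neg, pp3_c0 (by simp) (by simp; ring),
            pp3_c0 (by simp [pathMid]) (by simp [pathMid]; ring),
            pp3_c0 (by simp) (by simp; ring), pp3_iotaG_flat, pp3_pathEnd, pp3_pathOps i le_rfl,
            pp2_pathOps_one_self]
          rfl
      · rw [pp2_pathOps_one_of_ne hi (m := pathOps r m)]
        simp only [ppMid_DeltaMap_flat]
        apply path_ext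
        · rw [map_zsmul, pp1_c0 (by simp [pathMid]; ring) (by simp [pathMid]; ring), pp1_pathEnd,
            pp1_pathOps i le_rfl,
            (m i 1 _).map_coord_zero 0 (pp1_pathEnd _ _ _), map_zero, smul_zero]
        · rw [map_zsmul, pp2_c0 (by simp [pathMid]; ring) (by simp [pathMid]; ring), pp2_pathEnd,
            pp2_pathOps_one_of_ne hi, (m i 1 _).map_coord_zero 0 (ppMid_pathEnd _ _ _)]
          simp only [map_zero, smul_zero]
        · rw [map_zsmul, pp3_c0 (by simp [pathMid]; ring) (by simp [pathMid]; ring), pp3_pathEnd,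
            pp3_pathOps i le_rfl, pp2_pathOps_one_of_ne hi]
          rfl
    · rw [pp2_pathOps_of_two_le i hk (m := pathOps r m)]
      have hfst (kk : Fin k) : ∑ l, (pathShift r c kk l).1 + -(i : ℤ) = ∑ l, (c l).1 + -i + r := by
        rw [sum_pathShift_fst]; ring
      have hsnd (kk : Fin k) : ∑ l, (pathShift r c kk l).2 + (2 - (i : ℤ) - k)
          = ∑ l, (c l).2 + (2 - i - k) + r - 1 := by
        rw [sum_pathShift_snd]; ring
      apply path_ext
      · rw [map_zsmul, map_sum, pp1_pathEnd]
        symm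
        refine (congrArg _ (Finset.sum_eq_zero fun kk _ => ?_)).trans (smul_zero _)
        rw [pp1_c0 (hfst kk) (hsnd kk), pp1_pathOps i (one_le_two.trans hk),
          (m i k _).map_coord_zero kk, map_zero]
        rw [pathMix_DeltaMap_self, pp1_c0 (by simp [pathShift_self]) (by simp [pathShift_self]),
          pp1_pathEnd, map_zero]
      · rw [map_zsmul, map_sum, pp2_pathEnd]
        symm
        refine (congrArg _ (Finset.sum_eq_zero fun kk _ => ?_)).trans (smul_zero _)
        rw [pp2_c0 (hfst kk) (hsnd kk), pp2_pathOps_of_two_le i hk]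
        refine (congrArg _ ((congrArg _ (Finset.sum_eq_zero fun kk' _ => ?_)).trans
          (smul_zero _))).trans (map_zero _)
        obtain h | rfl | h := lt_trichotomy kk' kk
        · rw [(m i k _).map_coord_zero kk', map_zero]
          rw [pathMix_self, pathMix_DeltaMap_of_lt c h, map_zsmul,
            pp2_c0 (by simp [pathShift_of_ne c h.ne]) (by simp [pathShift_of_ne c h.ne]),
            pp2_iotaG_flat, map_zero, smul_zero, map_zero]
        · rw [(m i k _).map_coord_zero kk', map_zero]
          rw [pathMix_self, pathMix_DeltaMap_self,
            pp2_c0 (by simp [pathShift_self]) (by simp [pathShift_self]),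
            pp2_pathEnd, map_zero, map_zero]
        · rw [(m i k _).map_coord_zero kk, map_zero]
          rw [pathMix_of_lt _ h, pathMix_DeltaMap_self,
            pp1_c0 (by simp [pathShift_self]) (by simp [pathShift_self]),
            pp1_pathEnd, map_zero, map_zero, smul_zero]
      · rw [map_zsmul, map_sum, pp3_pathEnd, pp2_pathOps_of_two_le i hk]
        congr 1
        refine Finset.sum_congr rfl fun kk _ => ?_
        rw [pp3_c0 (hfst kk) (hsnd kk), pp3_pathOps i (one_le_two.trans hk)]
        congr 2
        funext l
        exact (pp3_pathMix_DeltaMap c kk l (a l)).symm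
  · rw [pp3_DeltaMap_flat, pp3_pathOps i hk]
    simp only [pp3_DeltaMap_flat]

end Path

/-- **Statement 19.** For a derived `A∞`-algebra `(A, m)` and `r ≥ 0`, the strict morphism
`ι_A : A → P_r(A)`, `x ↦ (x,0,x)`, is a morphism of derived `A∞`-algebras with
`∂⁻ ∘ ι = 1_A`; the map `Δ ⊗ 1_A` is a strict morphism of derived `A∞`-algebras
`P_r(A) → P_r(P_r(A))` with `(∂⁺ ⊗ 1) ∘ Δ = id` and `(∂⁻ ⊗ 1) ∘ Δ = ι ∘ ∂⁻`, so that
`Δ ⊗ 1_A` is an `r`-homotopy from `ι_A ∘ ∂⁻_A` to `1_{P_r(A)}`; consequently `ι_A` is an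
`r`-homotopy equivalence. -/
theorem dA_iota_rHomotopy_equivalence {R : Type} [CommRing R] (r : ℕ) (A : Bigraded R)
    (m : ∀ i k : ℕ, GMulti A A k (-(i : ℤ)) (2 - i - k)) (hA : IsdAInf A m) :
    -- `ι` is a morphism of derived `A∞`-algebras
    IsdAMor m (pathOps r m) (strictM (iotaG r A)) ∧
    -- `∂⁻ ∘ ι = 1_A`
    IsdAComp (strictM (iotaG r A)) (strictM (projMinusG r A)) (strictM (idG A)) ∧
    -- `Δ ⊗ 1` is a strict morphism of derived `A∞`-algebras
    IsdAMor (pathOps r m) (pathOps r (pathOps r m)) (strictM (DeltaMap r A)) ∧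
    -- `(∂⁺ ⊗ 1) ∘ Δ = id`
    IsdAComp (strictM (DeltaMap r A)) (strictM (projPlusG r (pathBG r A)))
      (strictM (idG (pathBG r A))) ∧
    -- `(∂⁻ ⊗ 1) ∘ Δ = ι ∘ ∂⁻`
    IsdAComp (strictM (DeltaMap r A)) (strictM (projMinusG r (pathBG r A)))
      (strictM (grecast 0 0 (by ring) (by ring) (gcomp (iotaG r A) (projMinusG r A)))) ∧
    -- `Δ ⊗ 1` is an `r`-homotopy from `ι ∘ ∂⁻` to the identity of `P_r(A)`
    IsdAHomotopy r (pathOps r m) (pathOps r m)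
      (strictM (grecast 0 0 (by ring) (by ring) (gcomp (iotaG r A) (projMinusG r A))))
      (strictM (idG (pathBG r A)))
      (strictM (DeltaMap r A)) ∧
    -- `ι` is an `r`-homotopy equivalence
    IsdAHtpEquiv r m (pathOps r m) (strictM (iotaG r A)) := by
  have hι : IsdAMor m (pathOps r m) (strictM (iotaG r A)) :=
    isdAMor_strictM _ fun i _ hk c a => iotaG_comm i hk c a
  have hιMinus : IsdAComp (strictM (iotaG r A)) (strictM (projMinusG r A)) (strictM (idG A)) :=
    isdAComp_strictM fun i j x => by rw [idG_flat, projMinusG_flat, pp1_iotaG_flat]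
  have hιPlus : IsdAComp (strictM (iotaG r A)) (strictM (projPlusG r A)) (strictM (idG A)) :=
    isdAComp_strictM fun i j x => by rw [idG_flat, projPlusG_flat, pp3_iotaG_flat]
  have hΔ : IsdAMor (pathOps r m) (pathOps r (pathOps r m)) (strictM (DeltaMap r A)) :=
    isdAMor_strictM (DeltaMap r A) fun i _ hk c a => DeltaMap_comm i hk c a
  have hΔPlus : IsdAComp (strictM (DeltaMap r A)) (strictM (projPlusG r (pathBG r A)))
      (strictM (idG (pathBG r A))) :=
    isdAComp_strictM (g := DeltaMap r A) fun i j w => by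
      rw [idG_flat, projPlusG_flat, pp3_DeltaMap_flat]
  have hΔMinus : IsdAComp (strictM (DeltaMap r A)) (strictM (projMinusG r (pathBG r A)))
      (strictM (grecast 0 0 (by ring) (by ring) (gcomp (iotaG r A) (projMinusG r A)))) :=
    isdAComp_strictM (g := DeltaMap r A) fun i j w => by
      rw [iota_projMinus_flat, projMinusG_flat, pp1_DeltaMap_flat]
  have hMinusι : IsdAComp (strictM (projMinusG r A)) (strictM (iotaG r A))
      (strictM (grecast 0 0 (by ring) (by ring) (gcomp (iotaG r A) (projMinusG r A)))) :=
    isdAComp_strictM fun i j w => by rw [iota_projMinus_flat, projMinusG_flat]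
  exact ⟨hι, hιMinus, hΔ, hΔPlus, hΔMinus, ⟨hΔ, hΔMinus, hΔPlus⟩,
    strictM (projMinusG r A), projMinusG_isdAMor, _, _, hMinusι, hιMinus,
    ⟨_, hΔ, hΔMinus, hΔPlus⟩, ⟨_, hι, hιMinus, hιPlus⟩⟩
end
end
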